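/- arXiv:0712.1398 — 2 statements merged into one kernel-verified Lean document; each statement's English description precedes it below -/
import Mathlib

section
/- Let g ⊊ so(V) be a proper Lie subalgebra acting irreducibly on V, and let p satisfy 4 ≤ p ≤ n. If T ∈ ΛᵖV is such that for all X₁,…,X_{p−2} ∈ V the 2-form X₁⌟⋯⌟X_{p−2}⌟T corresponds to an element of g, then T = 0. In other words, ΛᵖV ∩ (Λ^{p−2}V⊗g) = {0} for 4 ≤ p ≤ n. -/
open scoped RealInnerProductSpace BigOperators

noncomputable section

variable {V : Type} [NormedAddCommGroup V] [InnerProductSpace ℝ V] [FiniteDimensional ℝ V]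

/-- A skew-symmetric endomorphism of a real inner product space. -/
def IsSkew (A : V →ₗ[ℝ] V) : Prop := ∀ x y : V, ⟪A x, y⟫ = - ⟪x, A y⟫

namespace SkewProl

/-- Forms encoded as real functions on lists of vectors. -/
abbrev LF (V : Type) := List V → ℝ

/-- Contraction. -/
def ct {V : Type} (x : V) (T : LF V) : LF V := fun l => T (x :: l)

/-- The parity operator. -/
def hat {V : Type} (T : LF V) : LF V := fun l => (-1) ^ l.length * T l

/-- Wedge product (as a recursion on the list of arguments). -/
def wd {V : Type} : List V → LF V → LF V → ℝ
  | [], A, S => A [] * S []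
  | x :: l, A, S => wd l (ct x A) S + wd l (hat A) (ct x S)

/-- Iterated contraction. -/
def io {V : Type} (l : List V) (T : LF V) : LF V := fun l' => T (l ++ l')

section basic
variable {V : Type}

lemma ct_add (x : V) (A B : LF V) : ct x (A + B) = ct x A + ct x B := rfl
lemma ct_smul (x : V) (c : ℝ) (A : LF V) : ct x (c • A) = c • ct x A := rfl
lemma ct_neg (x : V) (A : LF V) : ct x (-A) = - ct x A := rfl
lemma ct_zero (x : V) : ct x (0 : LF V) = 0 := rfl
lemma hat_add (A B : LF V) : hat (A + B) = hat A + hat B := by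
  funext l; simp [hat, mul_add]
lemma hat_smul (c : ℝ) (A : LF V) : hat (c • A) = c • hat A := by
  funext l; simp [hat]; ring
lemma hat_neg (A : LF V) : hat (-A) = - hat A := by
  funext l; simp [hat]
lemma hat_hat (A : LF V) : hat (hat A) = A := by
  funext l; simp only [hat]; rw [← mul_assoc, ← mul_pow]; simp
lemma ct_hat (x : V) (A : LF V) : ct x (hat A) = - hat (ct x A) := by
  funext l; simp [hat, ct, pow_succ]
lemma hat_ct (x : V) (A : LF V) : hat (ct x A) = - ct x (hat A) := by
  rw [ct_hat]; simp

lemma wd_add_left (l : List V) : ∀ A B S : LF V, wd l (A + B) S = wd l A S + wd l B S := by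
  induction l with
  | nil => intro A B S; simp [wd, add_mul]
  | cons x l ih => intro A B S; simp only [wd, ct_add, hat_add, ih]; ring
lemma wd_add_right (l : List V) : ∀ A S B : LF V, wd l A (S + B) = wd l A S + wd l A B := by
  induction l with
  | nil => intro A B S; simp [wd, mul_add]
  | cons x l ih => intro A B S; simp only [wd, ct_add, ih]; ring
lemma wd_smul_left (c : ℝ) (l : List V) : ∀ A S : LF V, wd l (c • A) S = c * wd l A S := by
  induction l with
  | nil => intro A S; simp [wd, mul_assoc]
  | cons x l ih => intro A S; simp only [wd, ct_smul, hat_smul, ih]; ring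
lemma wd_smul_right (c : ℝ) (l : List V) : ∀ A S : LF V, wd l A (c • S) = c * wd l A S := by
  induction l with
  | nil => intro A S; simp [wd]; ring
  | cons x l ih => intro A S; simp only [wd, ct_smul, ih]; ring
lemma wd_neg_left (l : List V) (A S : LF V) : wd l (-A) S = - wd l A S := by
  have := wd_smul_left (-1) l A S; simpa using this
lemma wd_neg_right (l : List V) (A S : LF V) : wd l A (-S) = - wd l A S := by
  have := wd_smul_right (-1) l A S; simpa using this
lemma wd_zero_left (l : List V) (S : LF V) : wd l 0 S = 0 := by
  have := wd_smul_left 0 l 0 S; simpa using this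
lemma wd_zero_right (l : List V) (S : LF V) : wd l S 0 = 0 := by
  have := wd_smul_right 0 l S 0; simpa using this

/-- Super-commutativity. -/
lemma wd_swap (l : List V) : ∀ (ε δ : ℝ) (A S : LF V), (ε = 1 ∨ ε = -1) → (δ = 1 ∨ δ = -1) →
    hat A = ε • A → hat S = δ • S →
    wd l S A = (1 + ε + δ - ε * δ) / 2 * wd l A S := by
  induction l with
  | nil =>
    intro ε δ A S hε hδ hA hS
    have h1 := congrFun hA []
    have h2 := congrFun hS []
    simp [hat] at h1 h2
    simp only [wd]
    rcases hε with rfl | rfl <;> rcases hδ with rfl | rfl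
    · ring
    · have : S [] = 0 := by linarith
      simp [this]
    · have : A [] = 0 := by linarith
      simp [this]
    · have : A [] = 0 := by linarith
      simp [this]
  | cons x l ih =>
    intro ε δ A S hε hδ hA hS
    have hA' : hat (ct x A) = (-ε) • ct x A := by rw [hat_ct, hA, ct_smul]; simp
    have hS' : hat (ct x S) = (-δ) • ct x S := by rw [hat_ct, hS, ct_smul]; simp
    have hε' : (-ε = 1 ∨ -ε = -1) := by rcases hε with h | h <;> simp [h]
    have hδ' : (-δ = 1 ∨ -δ = -1) := by rcases hδ with h | h <;> simp [h]
    simp only [wd]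
    rw [hA, hS, wd_smul_left, wd_smul_left, ih _ _ _ _ hε hδ' hA hS', ih _ _ _ _ hε' hδ hA' hS]
    rcases hε with rfl | rfl <;> rcases hδ with rfl | rfl <;> ring

end basic

section forms
variable {V : Type} [NormedAddCommGroup V] [InnerProductSpace ℝ V]

/-- `k`-linear alternating forms. -/
structure Alt (k : ℕ) (T : LF V) : Prop where
  supp : ∀ l, l.length ≠ k → T l = 0
  add : ∀ l x y l', T (l ++ (x + y) :: l') = T (l ++ x :: l') + T (l ++ y :: l')
  smul : ∀ l (c : ℝ) x l', T (l ++ (c • x) :: l') = c * T (l ++ x :: l')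
  swap : ∀ l x y l', T (l ++ x :: y :: l') = - T (l ++ y :: x :: l')

lemma Alt.ct {k : ℕ} {T : LF V} (h : Alt (k + 1) T) (x : V) : Alt k (ct x T) where
  supp l hl := h.supp (x :: l) (by simpa using hl)
  add l y z l' := h.add (x :: l) y z l'
  smul l c y l' := h.smul (x :: l) c y l'
  swap l y z l' := h.swap (x :: l) y z l'

lemma Alt.io {k : ℕ} {T : LF V} (h : Alt k T) (l : List V) (j : ℕ) (hj : j + l.length = k) :
    Alt j (io l T) where
  supp l' hl := h.supp (l ++ l') (by simp; omega)
  add l₁ y z l' := by simpa [SkewProl.io] using h.add (l ++ l₁) y z l'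
  smul l₁ c y l' := by simpa [SkewProl.io] using h.smul (l ++ l₁) c y l'
  swap l₁ y z l' := by simpa [SkewProl.io] using h.swap (l ++ l₁) y z l'

lemma Alt.ct_add {k : ℕ} {T : LF V} (h : Alt k T) (x y : V) :
    SkewProl.ct (x + y) T = SkewProl.ct x T + SkewProl.ct y T := by
  funext l; exact h.add [] x y l
lemma Alt.ct_smul {k : ℕ} {T : LF V} (h : Alt k T) (c : ℝ) (x : V) :
    SkewProl.ct (c • x) T = c • SkewProl.ct x T := by
  funext l; exact h.smul [] c x l
lemma Alt.ct_swap {k : ℕ} {T : LF V} (h : Alt k T) (x y : V) :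
    SkewProl.ct x (SkewProl.ct y T) = - SkewProl.ct y (SkewProl.ct x T) := by
  funext l; exact h.swap [] y x l

lemma Alt.mk_ct {k : ℕ} {T : LF V} (h0 : T [] = 0) (h1 : ∀ x, Alt k (SkewProl.ct x T))
    (h2 : ∀ x y, SkewProl.ct (x + y) T = SkewProl.ct x T + SkewProl.ct y T)
    (h3 : ∀ (c : ℝ) x, SkewProl.ct (c • x) T = c • SkewProl.ct x T)
    (h4 : ∀ x y, SkewProl.ct x (SkewProl.ct y T) = - SkewProl.ct y (SkewProl.ct x T)) :
    Alt (k + 1) T where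
  supp l hl := by
    cases l with
    | nil => exact h0
    | cons x l => exact (h1 x).supp l (by simpa using hl)
  add l x y l' := by
    cases l with
    | nil => exact congrFun (h2 x y) l'
    | cons z l => exact (h1 z).add l x y l'
  smul l c x l' := by
    cases l with
    | nil => exact congrFun (h3 c x) l'
    | cons z l => exact (h1 z).smul l c x l'
  swap l x y l' := by
    cases l with
    | nil => exact congrFun (h4 y x) l'
    | cons z l => exact (h1 z).swap l x y l'

lemma Alt.hat {k : ℕ} {T : LF V} (h : Alt k T) : hat T = ((-1 : ℝ) ^ k) • T := by
  funext l
  by_cases hl : l.length = k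
  · simp [SkewProl.hat, hl]
  · simp [SkewProl.hat, h.supp l hl]

lemma Alt.smul' {k : ℕ} {T : LF V} (h : Alt k T) (c : ℝ) : Alt k (c • T) where
  supp l hl := by simp [h.supp l hl]
  add l x y l' := by simp [h.add, mul_add]
  smul l d x l' := by simp [h.smul]; ring
  swap l x y l' := by simp only [Pi.smul_apply, smul_eq_mul]; rw [h.swap]; ring

lemma Alt.add' {k : ℕ} {T S : LF V} (h : Alt k T) (h' : Alt k S) : Alt k (T + S) where
  supp l hl := by simp [h.supp l hl, h'.supp l hl]
  add l x y l' := by simp [h.add, h'.add]; ring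
  smul l d x l' := by simp [h.smul, h'.smul]; ring
  swap l x y l' := by simp only [Pi.add_apply]; rw [h.swap, h'.swap]; ring

lemma Alt.neg' {k : ℕ} {T : LF V} (h : Alt k T) : Alt k (-T) := by
  simpa using h.smul' (-1)

/-- moving a vector across a list. -/
lemma Alt.move {k : ℕ} {T : LF V} (h : Alt k T) (x : V) (l' : List V) :
    ∀ l l₀ : List V, T (l₀ ++ (l ++ x :: l')) = (-1) ^ l.length * T (l₀ ++ (x :: (l ++ l'))) := by
  intro l
  induction l with
  | nil => intro l₀; simp
  | cons y l ih =>
    intro l₀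
    have := ih (l₀ ++ [y])
    simp only [List.append_assoc, List.singleton_append] at this
    simp only [List.cons_append, this]
    rw [h.swap]
    simp [pow_succ]

lemma Alt.nodup {l : List V} : ∀ {k : ℕ} {T : LF V}, Alt k T → ¬ l.Nodup → T l = 0 := by
  induction l with
  | nil => intro k T _ h; simp at h
  | cons x l ih =>
    intro k T h hl
    by_cases hx : x ∈ l
    · obtain ⟨l₁, l₂, rfl⟩ := List.append_of_mem hx
      have h1 := h.move x l₂ l₁ [x]
      have h2 := h.swap [] x x (l₁ ++ l₂)
      simp only [List.nil_append, List.singleton_append] at h1 h2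
      rw [h1]
      have : T (x :: x :: (l₁ ++ l₂)) = 0 := by linarith
      simp [this]
    · have hl' : ¬ l.Nodup := fun h => hl (List.nodup_cons.2 ⟨hx, h⟩)
      cases k with
      | zero => exact h.supp _ (by simp)
      | succ k => exact ih (h.ct x) hl'

variable [FiniteDimensional ℝ V]

/-- The Poisson bracket of forms. -/
def br (A S : LF V) : LF V := fun l =>
  ∑ a, wd l (ct (stdOrthonormalBasis ℝ V a) A) (ct (stdOrthonormalBasis ℝ V a) S)

lemma br_neg_left (A S : LF V) : br (-A) S = - br A S := by
  funext l; simp [br, ct_neg, wd_neg_left]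
lemma br_neg_right (A S : LF V) : br A (-S) = - br A S := by
  funext l; simp [br, ct_neg, wd_neg_right]
lemma br_add_left (A B S : LF V) : br (A + B) S = br A S + br B S := by
  funext l; simp [br, ct_add, wd_add_left, Finset.sum_add_distrib]
lemma br_add_right (A B S : LF V) : br S (A + B) = br S A + br S B := by
  funext l; simp [br, ct_add, wd_add_right, Finset.sum_add_distrib]
lemma br_smul_left (c : ℝ) (A S : LF V) : br (c • A) S = c • br A S := by
  funext l; simp [br, ct_smul, wd_smul_left, Finset.mul_sum]
lemma br_smul_right (c : ℝ) (A S : LF V) : br A (c • S) = c • br A S := by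
  funext l; simp [br, ct_smul, wd_smul_right, Finset.mul_sum]
lemma br_zero_left (S : LF V) : br 0 S = 0 := by
  simpa using br_smul_left 0 0 S
lemma br_zero_right (S : LF V) : br S 0 = 0 := by
  simpa using br_smul_right 0 S 0

lemma ct_br {j k : ℕ} {A S : LF V} (hA : Alt j A) (hS : Alt k S) (x : V) :
    ct x (br A S) = - br (ct x A) S + br (hat A) (ct x S) := by
  funext l
  simp only [ct, br, wd, Pi.add_apply, Pi.neg_apply]
  rw [Finset.sum_add_distrib, ← Finset.sum_neg_distrib]
  congr 1
  · refine Finset.sum_congr rfl fun a _ => ?_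
    have h2 := hA.ct_swap x (stdOrthonormalBasis ℝ V a)
    change wd l (ct x (ct (stdOrthonormalBasis ℝ V a) A)) _ = _
    rw [h2, wd_neg_left]
  · refine Finset.sum_congr rfl fun a _ => ?_
    have h2 := hS.ct_swap x (stdOrthonormalBasis ℝ V a)
    change wd l (hat (ct (stdOrthonormalBasis ℝ V a) A))
      (ct x (ct (stdOrthonormalBasis ℝ V a) S)) = _
    rw [hat_ct, h2, wd_neg_left, wd_neg_right, neg_neg]

lemma wd_supp {V : Type} (l : List V) : ∀ (j k : ℤ) (A S : LF V),
    (∀ l, (l.length : ℤ) ≠ j → A l = 0) → (∀ l, (l.length : ℤ) ≠ k → S l = 0) →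
    (l.length : ℤ) ≠ j + k → wd l A S = 0 := by
  induction l with
  | nil =>
    intro j k A S hA hS h
    simp only [wd]
    by_cases hj : j = 0
    · rw [hS [] (by simp at h ⊢; omega)]; simp
    · rw [hA [] (by simp; omega)]; simp
  | cons x l ih =>
    intro j k A S hA hS h
    simp only [wd]
    rw [ih (j - 1) k, ih j (k - 1)]
    · simp
    · intro l hl; simp [hat, hA l hl]
    · intro l hl; exact hS _ (by simp; omega)
    · simp at h; omega
    · intro l hl; exact hA _ (by simp; omega)
    · exact hS
    · simp at h; omega

lemma Alt.ct' {V : Type} [NormedAddCommGroup V] [InnerProductSpace ℝ V] {k : ℕ} {T : LF V}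
    (h : Alt k T) (x : V) : Alt (k - 1) (SkewProl.ct x T) where
  supp l hl := h.supp (x :: l) (by simp; omega)
  add l y z l' := h.add (x :: l) y z l'
  smul l c y l' := h.smul (x :: l) c y l'
  swap l y z l' := h.swap (x :: l) y z l'

lemma br_cons {j k : ℕ} {A S : LF V} (hA : Alt j A) (hS : Alt k S) (x : V) (l : List V) :
    br A S (x :: l) = - br (ct x A) S l + (-1) ^ j * br A (ct x S) l := by
  have := congrFun (ct_br hA hS x) l
  rw [hA.hat, br_smul_left] at this
  simpa [ct] using this

lemma Alt.br {n j k : ℕ} {A S : LF V} (hA : Alt j A) (hS : Alt k S) (hn : j + k = n + 2) :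
    Alt n (br A S) where
  supp l hl := by
    unfold SkewProl.br
    refine Finset.sum_eq_zero fun a _ => wd_supp l (j - 1) (k - 1) _ _ ?_ ?_ (by omega)
    · intro l hl; exact hA.supp _ (by simp; omega)
    · intro l hl; exact hS.supp _ (by simp; omega)
  add l x y l' := by
    clear hn
    induction l generalizing j k A S with
    | nil =>
      simp only [List.nil_append]
      rw [br_cons hA hS, br_cons hA hS, br_cons hA hS, hA.ct_add, hS.ct_add, br_add_left,
        br_add_right]
      simp; ring
    | cons z l ih =>
      simp only [List.cons_append]
      rw [br_cons hA hS, br_cons hA hS, br_cons hA hS, ih (hA.ct' z) hS, ih hA (hS.ct' z)]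
      ring
  smul l c x l' := by
    clear hn
    induction l generalizing j k A S with
    | nil =>
      simp only [List.nil_append]
      rw [br_cons hA hS, br_cons hA hS, hA.ct_smul, hS.ct_smul, br_smul_left,
        br_smul_right]
      simp; ring
    | cons z l ih =>
      simp only [List.cons_append]
      rw [br_cons hA hS, br_cons hA hS, ih (hA.ct' z) hS, ih hA (hS.ct' z)]
      ring
  swap l x y l' := by
    clear hn
    induction l generalizing j k A S with
    | nil =>
      simp only [List.nil_append]
      have hp : ((-1 : ℝ) ^ (j - 1) + (-1) ^ j) • SkewProl.br (SkewProl.ct x A) (SkewProl.ct y S) = 0 ∧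
          ((-1 : ℝ) ^ (j - 1) + (-1) ^ j) • SkewProl.br (SkewProl.ct y A) (SkewProl.ct x S) = 0 := by
        cases j with
        | zero =>
          have h1 : ∀ x, SkewProl.ct x A = 0 := fun x => by
            funext l; exact hA.supp _ (by simp)
          simp [h1, br_zero_left]
        | succ j => simp [pow_succ]
      have h1 := congrFun hp.1 l'
      have h2 := congrFun hp.2 l'
      simp only [Pi.smul_apply, smul_eq_mul, Pi.zero_apply] at h1 h2
      rw [br_cons hA hS, br_cons hA hS, br_cons (hA.ct' x) hS, br_cons hA (hS.ct' x),
        br_cons (hA.ct' y) hS, br_cons hA (hS.ct' y), hA.ct_swap x y, hS.ct_swap x y, br_neg_left,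
        br_neg_right]
      simp only [Pi.neg_apply]
      linear_combination -h1 -h2
    | cons z l ih =>
      simp only [List.cons_append]
      rw [br_cons hA hS, br_cons hA hS, ih (hA.ct' z) hS, ih hA (hS.ct' z)]
      ring

/-- scalars -/
def sc (c : ℝ) : LF V := fun l => if l = [] then c else 0

lemma hat_sc (c : ℝ) : hat (sc c : LF V) = sc c := by
  funext l; by_cases h : l = [] <;> simp [hat, sc, h]
lemma ct_sc (x : V) (c : ℝ) : ct x (sc c : LF V) = 0 := by
  funext l; simp [ct, sc]

lemma wd_sc_left (l : List V) (c : ℝ) : ∀ S : LF V, wd l (sc c) S = c * S l := by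
  induction l with
  | nil => intro S; simp [wd, sc]
  | cons x l ih => intro S; simp only [wd, hat_sc, ct_sc, ih, wd_zero_left]; simp [ct]

lemma wd_sc_right (l : List V) (c : ℝ) : ∀ S : LF V, wd l S (sc c) = c * S l := by
  induction l with
  | nil => intro S; simp [wd, sc]; ring
  | cons x l ih => intro S; simp only [wd, ct_sc, ih, wd_zero_right]; simp [ct]

/-- vector attached to a 1-form -/
lemma Alt.vec {A : LF V} (hA : Alt 1 A) (v : V) (hv : ∀ x, ⟪v, x⟫ = A [x]) {k : ℕ} {S : LF V}
    (hS : Alt k S) : SkewProl.br A S = SkewProl.ct v S := by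
  have h1 : ∀ x, SkewProl.ct x A = sc ⟪v, x⟫ := by
    intro x; funext l
    cases l with
    | nil => simp [SkewProl.ct, sc, hv]
    | cons y l => simpa [SkewProl.ct, sc] using hA.supp (x :: y :: l) (by simp)
  funext l
  simp only [SkewProl.br, h1, wd_sc_left]
  conv_rhs => rw [← (stdOrthonormalBasis ℝ V).sum_repr' v]
  have h2 : ∀ (s : Finset (Fin (Module.finrank ℝ V))) (c : Fin (Module.finrank ℝ V) → ℝ),
      SkewProl.ct (∑ a ∈ s, c a • stdOrthonormalBasis ℝ V a) S l
       = ∑ a ∈ s, c a * SkewProl.ct (stdOrthonormalBasis ℝ V a) S l := by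
    intro s c
    induction s using Finset.induction_on with
    | empty => simpa using congrFun (hS.ct_smul 0 0) l
    | insert a s ha ih =>
      rw [Finset.sum_insert ha, Finset.sum_insert ha, hS.ct_add, hS.ct_smul, Pi.add_apply, ih]
      simp
  rw [h2]
  refine Finset.sum_congr rfl fun a _ => ?_
  rw [real_inner_comm]

lemma Alt.vec_right {A : LF V} (hA : Alt 1 A) (v : V) (hv : ∀ x, ⟪v, x⟫ = A [x]) {k : ℕ} {S : LF V}
    (hS : Alt k S) : SkewProl.br S A = SkewProl.ct v S := by
  rw [← hA.vec v hv hS]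
  have h1 : ∀ x, SkewProl.ct x A = sc ⟪v, x⟫ := by
    intro x; funext l
    cases l with
    | nil => simp [SkewProl.ct, sc, hv]
    | cons y l => simpa [SkewProl.ct, sc] using hA.supp (x :: y :: l) (by simp)
  funext l
  simp only [SkewProl.br, h1, wd_sc_left, wd_sc_right]

lemma Alt.exists_vec {A : LF V} (hA : Alt 1 A) : ∃ v : V, ∀ x, ⟪v, x⟫ = A [x] := by
  let f : V →ₗ[ℝ] ℝ :=
    { toFun := fun x => A [x]
      map_add' := fun x y => hA.add [] x y []
      map_smul' := fun c x => hA.smul [] c x [] }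
  refine ⟨(InnerProductSpace.toDual ℝ V).symm (LinearMap.toContinuousLinearMap f), fun x => ?_⟩
  rw [InnerProductSpace.toDual_symm_apply]
  rfl

/-- The prolongation condition. -/
def InG (g : Submodule ℝ (V →ₗ[ℝ] V)) (k : ℕ) (T : LF V) : Prop :=
  ∀ l : List V, l.length + 2 = k → ∃ A ∈ g, ∀ Y Z : V, ⟪A Y, Z⟫ = T (l ++ [Y, Z])

lemma InG.ct {g : Submodule ℝ (V →ₗ[ℝ] V)} {k : ℕ} {T : LF V} (h : InG g k T) (x : V) :
    InG g (k - 1) (SkewProl.ct x T) := by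
  intro l hl
  exact h (x :: l) (by simp; omega)

lemma br_two (A S : LF V) (hA : Alt 2 A) (hS : Alt 2 S) (A' S' : V →ₗ[ℝ] V)
    (hA' : ∀ Y Z : V, ⟪A' Y, Z⟫ = A [Y, Z]) (hS' : ∀ Y Z : V, ⟪S' Y, Z⟫ = S [Y, Z])
    (sA : IsSkew A') (sS : IsSkew S') (Y Z : V) :
    br A S [Y, Z] = ⟪(A' ∘ₗ S' - S' ∘ₗ A') Y, Z⟫ := by
  have h0 : ∀ a, A [a] = 0 := fun a => hA.supp _ (by simp)
  have h1 : ∀ a, S [a] = 0 := fun a => hS.supp _ (by simp)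
  simp only [br, wd, ct, hat]
  simp only [h0, h1, ← hA', ← hS']
  have e1 : ∀ P Q : V →ₗ[ℝ] V, IsSkew P → IsSkew Q → ∀ Y Z : V,
      ∑ a, ⟪P (stdOrthonormalBasis ℝ V a), Y⟫ * ⟪Q (stdOrthonormalBasis ℝ V a), Z⟫ = ⟪P Y, Q Z⟫ := by
    intro P Q hP hQ Y Z
    rw [← (stdOrthonormalBasis ℝ V).sum_inner_mul_inner]
    refine Finset.sum_congr rfl fun a _ => ?_
    rw [hP, hQ, real_inner_comm]; ring
  have e2 := e1 A' S' sA sS Y Z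
  have e3 := e1 A' S' sA sS Z Y
  simp only [LinearMap.sub_apply, LinearMap.comp_apply, inner_sub_left]
  have e4 := sA (S' Y) Z
  have e5 := sS (A' Y) Z
  have e6 := real_inner_comm (S' Y) (A' Z)
  calc _ = ∑ a, ⟪A' (stdOrthonormalBasis ℝ V a), Y⟫ * ⟪S' (stdOrthonormalBasis ℝ V a), Z⟫
        - ∑ a, ⟪A' (stdOrthonormalBasis ℝ V a), Z⟫ * ⟪S' (stdOrthonormalBasis ℝ V a), Y⟫ := by
        rw [← Finset.sum_sub_distrib]
        refine Finset.sum_congr rfl fun a _ => ?_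
        simp
        ring
    _ = _ := by rw [e2, e3]; linarith

lemma InG.br (g : Submodule ℝ (V →ₗ[ℝ] V)) (hgskew : ∀ A ∈ g, IsSkew A)
    (hglie : ∀ A ∈ g, ∀ B ∈ g, A ∘ₗ B - B ∘ₗ A ∈ g) (l : List V) :
    ∀ {j k : ℕ} {A S : LF V}, 1 ≤ j → 1 ≤ k → Alt j A → Alt k S → InG g j A → InG g k S →
    l.length + 4 = j + k → ∃ B ∈ g, ∀ Y Z : V, ⟪B Y, Z⟫ = br A S (l ++ [Y, Z]) := by
  induction l with
  | nil =>
    intro j k A S hj hk hA hS gA gS hl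
    simp at hl
    obtain rfl | h2 := eq_or_lt_of_le hj
    · obtain ⟨v, hv⟩ := hA.exists_vec
      rw [hA.vec v hv hS]
      exact gS [v] (by simp; omega)
    obtain rfl | h3 := eq_or_lt_of_le hk
    · obtain ⟨v, hv⟩ := hS.exists_vec
      rw [hS.vec_right v hv hA]
      exact gA [v] (by simp; omega)
    obtain rfl : j = 2 := by omega
    obtain rfl : k = 2 := by omega
    obtain ⟨A', hA', hA''⟩ := gA [] rfl
    obtain ⟨S', hS', hS''⟩ := gS [] rfl
    exact ⟨_, hglie A' hA' S' hS', fun Y Z =>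
      (br_two A S hA hS A' S' hA'' hS'' (hgskew _ hA') (hgskew _ hS') Y Z).symm⟩
  | cons x l ih =>
    intro j k A S hj hk hA hS gA gS hl
    simp at hl
    obtain rfl | h2 := eq_or_lt_of_le hj
    · obtain ⟨v, hv⟩ := hA.exists_vec
      rw [hA.vec v hv hS]
      exact gS (v :: x :: l) (by simp; omega)
    obtain rfl | h3 := eq_or_lt_of_le hk
    · obtain ⟨v, hv⟩ := hS.exists_vec
      rw [hS.vec_right v hv hA]
      exact gA (v :: x :: l) (by simp; omega)
    obtain ⟨B, hB, hB'⟩ := ih (by omega) hk (hA.ct' x) hS (gA.ct x) gS (by omega)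
    obtain ⟨C, hC, hC'⟩ := ih hj (by omega) hA (hS.ct' x) gA (gS.ct x) (by omega)
    refine ⟨- B + ((-1 : ℝ) ^ j) • C, g.add_mem (g.neg_mem hB) (g.smul_mem _ hC), fun Y Z => ?_⟩
    rw [List.cons_append, br_cons hA hS, ← hB', ← hC']
    simp [inner_add_left, inner_smul_left]

/-- Filippov identity for forms of top degree. -/
lemma filippov (g : Submodule ℝ (V →ₗ[ℝ] V)) (hgskew : ∀ A ∈ g, IsSkew A)
    (hglie : ∀ A ∈ g, ∀ B ∈ g, A ∘ₗ B - B ∘ₗ A ∈ g) (p : ℕ) (hp : 3 ≤ p)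
    (htop : ∀ k, p < k → ∀ T : LF V, Alt k T → InG g k T → T = 0)
    (T : LF V) (hT : Alt p T) (gT : InG g p T) (l : List V) (hl : l.length + 2 = p) :
    br (io l T) T = 0 := by
  have gio : ∀ l : List V, InG g (p - l.length) (io l T) := by
    intro l l' hl'
    simpa [io] using gT (l ++ l') (by simp; omega)
  have h0 : ∀ l₁ l₂ : List V, l₁.length + l₂.length + 3 = p → br (io l₁ T) (io l₂ T) = 0 := by
    intro l₁ l₂ h
    have a1 := hT.io l₁ (p - l₁.length) (by omega)
    have a2 := hT.io l₂ (p - l₂.length) (by omega)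
    refine htop (p + 1) (by omega) _ (a1.br a2 (by omega)) ?_
    intro l hl
    exact InG.br g hgskew hglie l (by omega) (by omega) a1 a2 (gio _) (gio _) (by omega)
  have h1 : ∀ (x : V) (l₁ l₂ : List V), l₁.length + l₂.length + 3 = p →
      br (io (l₁ ++ [x]) T) (io l₂ T) = - br (io l₁ T) (io (x :: l₂) T) := by
    intro x l₁ l₂ h
    have a1 := hT.io l₁ (p - l₁.length) (by omega)
    have a2 := hT.io l₂ (p - l₂.length) (by omega)
    have e1 := ct_br a1 a2 x
    rw [h0 l₁ l₂ h, a1.hat, br_smul_left] at e1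
    have e2 : ct x (io l₁ T) = io (l₁ ++ [x]) T := by funext l; simp [ct, io]
    have e3 : ct x (io l₂ T) = ((-1 : ℝ) ^ l₂.length) • io (x :: l₂) T := by
      funext l
      have := hT.move x l l₂ []
      simpa [ct, io] using this
    rw [e2, e3, br_smul_right, smul_smul, ← pow_add, ct_zero] at e1
    have e4 : ((-1 : ℝ)) ^ (p - l₁.length + l₂.length) = -1 := by
      apply Odd.neg_one_pow
      exact ⟨l₂.length + 1, by omega⟩
    rw [e4] at e1
    have := eq_neg_of_add_eq_zero_left e1.symm
    rw [neg_smul, one_smul, neg_neg] at this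
    rw [← this, neg_neg]
  have h2 : ∀ l₁ l₂ : List V, l₁.length + l₂.length + 2 = p →
      br (io l₁ T) (io l₂ T) = ((-1 : ℝ) ^ l₁.length) • br T (io (l₁ ++ l₂) T) := by
    intro l₁
    induction l₁ using List.reverseRecOn with
    | nil => intro l₂ h; simp; rfl
    | append_singleton l x ih =>
      intro l₂ h
      simp at h
      rw [h1 x l l₂ (by omega), ih (x :: l₂) (by simp; omega)]
      simp [pow_succ]
  have h3 := h2 l [] (by simpa using hl)
  have h4 : (io [] T) = T := by funext l; simp [io]
  rw [h4, List.append_nil] at h3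
  have aD := hT.io l 2 (by omega)
  have h5 : br (io l T) T = ((-1 : ℝ) ^ (p - 1)) • br T (io l T) := by
    funext l'
    simp only [br, Pi.smul_apply, smul_eq_mul, Finset.mul_sum]
    refine Finset.sum_congr rfl fun a _ => ?_
    have q1 := (aD.ct' (stdOrthonormalBasis ℝ V a)).hat
    have q2 := (hT.ct' (stdOrthonormalBasis ℝ V a)).hat
    rw [wd_swap l' _ _ _ _ (neg_one_pow_eq_or ℝ (p-1)) (neg_one_pow_eq_or ℝ (2-1)) q2 q1]
    congr 1
    norm_num
  have h6 : ((-1 : ℝ)) ^ (p - 1) = - (-1) ^ l.length := by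
    have : p - 1 = l.length + 1 := by omega
    rw [this, pow_succ]; ring
  rw [h6] at h5
  rw [h5, neg_smul] at h3
  have h7 : ((-1 : ℝ) ^ l.length) • br T (io l T) = 0 := by
    have := self_eq_neg.1 h3.symm
    exact this
  rw [h5, neg_smul, h7, neg_zero]

/-- derivation action -/
def act (D : V → V) : LF V → List V → ℝ
  | _, [] => 0
  | T, z :: l => T (D z :: l) + act D (ct z T) l

lemma br_act {D : LF V} (hD : Alt 2 D) (D' : V → V) (hD' : ∀ Y Z : V, ⟪D' Y, Z⟫ = D [Y, Z])
    (l : List V) : ∀ {k : ℕ} {T : LF V}, Alt k T → br D T l = - act D' T l := by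
  induction l with
  | nil =>
    intro k T hT
    simp only [br, wd, act, ct]
    simp [hD.supp [_] (by simp)]
  | cons z l ih =>
    intro k T hT
    rw [br_cons hD hT, act, ih (hT.ct' z), (hD.ct z).vec (D' z) (fun x => hD' z x) hT]
    simp [ct]; ring

lemma act_ofFn (D : V → V) : ∀ (p : ℕ) (F : LF V) (z : Fin p → V),
    act D F (List.ofFn z) = ∑ k, F (List.ofFn (Function.update z k (D (z k)))) := by
  intro p
  induction p with
  | zero => intro F z; simp [act]
  | succ p ih =>
    intro F z
    rw [List.ofFn_succ, act, ih, Fin.sum_univ_succ]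
    congr 1
    · rw [List.ofFn_succ]; simp
    · refine Finset.sum_congr rfl fun k _ => ?_
      rw [List.ofFn_succ]
      simp only [ct]
      congr 1
      congr 1
      congr 1
      funext i
      by_cases h : i = k
      · subst h; simp
      · simp [Function.update_of_ne h, Function.update_of_ne (fun h' => h (Fin.succ_injective _ h'))]


/-- From alternating maps to functions on lists. -/
def ofAlt : (k : ℕ) → AlternatingMap ℝ V ℝ (Fin k) → LF V
  | 0, T, l => if l = [] then T ![] else 0
  | _ + 1, _, [] => 0
  | k + 1, T, x :: l => ofAlt k (T.curryLeft x) l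

lemma ofAlt_add (k : ℕ) : ∀ T S : AlternatingMap ℝ V ℝ (Fin k),
    ofAlt k (T + S) = ofAlt k T + ofAlt k S := by
  induction k with
  | zero => intro T S; funext l; by_cases h : l = [] <;> simp [ofAlt, h]
  | succ k ih =>
    intro T S; funext l
    cases l with
    | nil => simp [ofAlt]
    | cons x l =>
      simp only [ofAlt, Pi.add_apply]
      rw [AlternatingMap.curryLeft_add, LinearMap.add_apply, ih]; rfl

lemma ofAlt_smul (k : ℕ) : ∀ (c : ℝ) (T : AlternatingMap ℝ V ℝ (Fin k)),
    ofAlt k (c • T) = c • ofAlt k T := by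
  induction k with
  | zero => intro c T; funext l; by_cases h : l = [] <;> simp [ofAlt, h]
  | succ k ih =>
    intro c T; funext l
    cases l with
    | nil => simp [ofAlt]
    | cons x l =>
      simp only [ofAlt, Pi.smul_apply]
      rw [AlternatingMap.curryLeft_smul, LinearMap.smul_apply, ih]; rfl

lemma ct_ofAlt (k : ℕ) (T : AlternatingMap ℝ V ℝ (Fin (k + 1))) (x : V) :
    ct x (ofAlt (k + 1) T) = ofAlt k (T.curryLeft x) := rfl

lemma alt_ofAlt (k : ℕ) : ∀ T : AlternatingMap ℝ V ℝ (Fin k), Alt k (ofAlt k T) := by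
  induction k with
  | zero =>
    intro T
    refine ⟨?_, ?_, ?_, ?_⟩
    · intro l hl; simp [ofAlt]; intro h; simp [h] at hl
    all_goals intros; simp [ofAlt]
  | succ k ih =>
    intro T
    refine Alt.mk_ct rfl (fun x => by rw [ct_ofAlt]; exact ih _) ?_ ?_ ?_
    · intro x y; simp only [ct_ofAlt, map_add, ofAlt_add]
    · intro c x; simp only [ct_ofAlt, map_smul, ofAlt_smul]
    · intro x y
      cases k with
      | zero => funext l; simp [ct, ofAlt]
      | succ k =>
        simp only [ct_ofAlt]
        have h : ((T.curryLeft y).curryLeft x) = (-1 : ℝ) • ((T.curryLeft x).curryLeft y) := by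
          have h1 := T.curryLeft_same (x + y)
          have h2 := T.curryLeft_same x
          have h3 := T.curryLeft_same y
          simp only [map_add, AlternatingMap.curryLeft_add, LinearMap.add_apply] at h1
          rw [h2, h3] at h1
          ext z
          have h4 := congrArg (fun R => R z) h1
          simp only [AlternatingMap.add_apply, AlternatingMap.zero_apply] at h4
          simp only [AlternatingMap.smul_apply, smul_eq_mul]
          linarith
        rw [h, ofAlt_smul]; simp

lemma ofAlt_ofFn (k : ℕ) : ∀ (T : AlternatingMap ℝ V ℝ (Fin k)) (z : Fin k → V),
    ofAlt k T (List.ofFn z) = T z := by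
  induction k with
  | zero => intro T z; simp [ofAlt]; congr 1; exact Subsingleton.elim _ _
  | succ k ih =>
    intro T z
    rw [List.ofFn_succ]
    simp only [ofAlt]
    rw [ih, AlternatingMap.curryLeft_apply_apply]
    congr 1
    exact Fin.cons_self_tail z

lemma ofFn_snoc (m : ℕ) (ζ : Fin m → V) (Y Z : V) :
    List.ofFn (Fin.snoc (Fin.snoc ζ Y : Fin (m + 1) → V) Z : Fin (m + 2) → V)
      = List.ofFn ζ ++ [Y, Z] := by
  rw [List.ofFn_succ', List.ofFn_succ']
  simp [List.concat_eq_append]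

lemma inG_ofAlt (g : Submodule ℝ (V →ₗ[ℝ] V)) (m : ℕ) (T : AlternatingMap ℝ V ℝ (Fin (m + 2)))
    (hT : ∀ ζ : Fin m → V, ∃ A ∈ g, ∀ Y Z : V,
      ⟪A Y, Z⟫ = T (Fin.snoc (Fin.snoc ζ Y) Z)) : InG g (m + 2) (ofAlt (m + 2) T) := by
  intro l hl
  obtain rfl : l.length = m := by omega
  obtain ⟨A, hA, h⟩ := hT l.get
  refine ⟨A, hA, fun Y Z => ?_⟩
  rw [h, ← ofAlt_ofFn, ofFn_snoc, List.ofFn_get]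

lemma Alt.toAlt {k : ℕ} {F : LF V} (hF : Alt k F) :
    ∃ T : AlternatingMap ℝ V ℝ (Fin k), ∀ z, T z = F (List.ofFn z) := by
  have key : ∀ (z : Fin k → V) (i : Fin k) (v : V), List.ofFn (Function.update z i v)
      = (List.ofFn z).take i ++ v :: (List.ofFn z).drop (i + 1) := by
    intro z i v
    have h := List.set_eq_take_append_cons_drop (l := List.ofFn z) (i := (i : ℕ)) (a := v)
    rw [if_pos (by simp)] at h
    rw [← h]
    apply List.ext_get
    · simp
    · intro n h1 h2
      simp only [List.get_eq_getElem, List.getElem_ofFn, List.getElem_set]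
      by_cases hn : (i : ℕ) = n
      · subst hn; simp
      · rw [if_neg hn, Function.update_of_ne]
        intro h'; apply hn; rw [← h']
  refine ⟨{ toFun := fun z => F (List.ofFn z), map_update_add' := ?_, map_update_smul' := ?_,
            map_eq_zero_of_eq' := ?_ }, fun z => rfl⟩
  · intro inst z i x y
    have : inst = instDecidableEqFin k := Subsingleton.elim _ _
    subst this
    rw [key, key, key, hF.add]
  · intro inst z i c x
    have : inst = instDecidableEqFin k := Subsingleton.elim _ _
    subst this
    rw [key, key, hF.smul]; rfl
  · intro z i j hij hne
    apply hF.nodup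
    rw [List.nodup_ofFn]
    exact fun h => hne (h hij)

lemma Alt.eq_zero_of {k : ℕ} {F : LF V} (hF : Alt k F) (h : ∀ z : Fin k → V, F (List.ofFn z) = 0) :
    F = 0 := by
  funext l
  by_cases hl : l.length = k
  · subst hl
    simpa using h l.get
  · exact hF.supp l hl

lemma exists_perm (m : ℕ) (i j : Fin (m + 2)) (hij : i ≠ j) : ∃ σ : Equiv.Perm (Fin (m + 2)),
    σ (Fin.castSucc (Fin.last m)) = i ∧ σ (Fin.last (m + 1)) = j := by
  have hab : (Fin.castSucc (Fin.last m)) ≠ (Fin.last (m + 1)) := by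
    intro h; simp [Fin.ext_iff] at h
  set a := Fin.castSucc (Fin.last m)
  set b := Fin.last (m + 1)
  refine ⟨Equiv.swap (Equiv.swap a i b) j * Equiv.swap a i, ?_, ?_⟩
  · rw [Equiv.Perm.mul_apply, Equiv.swap_apply_left]
    apply Equiv.swap_apply_of_ne_of_ne _ hij
    intro h
    have : Equiv.swap a i a = Equiv.swap a i b := by rw [Equiv.swap_apply_left]; exact h
    exact hab ((Equiv.swap a i).injective this)
  · rw [Equiv.Perm.mul_apply, Equiv.swap_apply_left]

/-- Existence of a form of top degree satisfying the Filippov identity. -/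
lemma exists_top (g : Submodule ℝ (V →ₗ[ℝ] V)) (hgskew : ∀ A ∈ g, IsSkew A)
    (hglie : ∀ A ∈ g, ∀ B ∈ g, A ∘ₗ B - B ∘ₗ A ∈ g)
    (m : ℕ) (hp4 : 4 ≤ m + 2) (T : AlternatingMap ℝ V ℝ (Fin (m + 2)))
    (hT : ∀ ζ : Fin m → V, ∃ A ∈ g, ∀ Y Z : V,
      ⟪A Y, Z⟫ = T (Fin.snoc (Fin.snoc ζ Y) Z)) (hT0 : T ≠ 0) :
    ∃ (p : ℕ), 4 ≤ p ∧ ∃ S : AlternatingMap ℝ V ℝ (Fin p), S ≠ 0 ∧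
      ∀ (x : Fin p → V) (i j : Fin p), i ≠ j → ∃ A ∈ g,
        (∀ Y Z : V, ⟪A Y, Z⟫ = S (Function.update (Function.update x i Y) j Z)) ∧
        ∀ z : Fin p → V, ∑ k, S (Function.update z k (A (z k))) = 0 := by
  classical
  let P : ℕ → Prop := fun k => ∃ F : LF V, Alt k F ∧ InG g k F ∧ F ≠ 0
  have hP : P (m + 2) := by
    refine ⟨ofAlt (m + 2) T, alt_ofAlt _ T, inG_ofAlt g m T hT, fun h => hT0 ?_⟩
    ext z
    rw [← ofAlt_ofFn, h]; rfl
  have hb : ∀ k, P k → k ≤ Module.finrank ℝ V := by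
    rintro k ⟨F, hF, -, h0⟩
    by_contra hk
    apply h0
    obtain ⟨S, hS⟩ := hF.toAlt
    apply hF.eq_zero_of
    intro z
    rw [← hS]
    apply S.map_linearDependent
    intro hli
    have := hli.fintype_card_le_finrank
    simp at this
    omega
  set p := Nat.findGreatest P (Module.finrank ℝ V) with hp
  have hPp : P p := Nat.findGreatest_spec (hb _ hP) hP
  have hmp : m + 2 ≤ p := Nat.le_findGreatest (hb _ hP) hP
  have htop : ∀ k, p < k → ∀ T : LF V, Alt k T → InG g k T → T = 0 := by
    intro k hk T h1 h2
    by_contra h3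
    have hPk : P k := ⟨T, h1, h2, h3⟩
    have := Nat.le_findGreatest (hb _ hPk) hPk
    omega
  clear_value p
  obtain ⟨F, hF, gF, F0⟩ := hPp
  obtain ⟨S, hS⟩ := hF.toAlt
  refine ⟨p, by omega, S, ?_, ?_⟩
  · intro h
    apply F0
    apply hF.eq_zero_of
    intro z; rw [← hS, h]; rfl
  · intro x i j hij
    obtain ⟨q, rfl⟩ : ∃ q, p = q + 2 := ⟨p - 2, by omega⟩
    obtain ⟨σ, hσi, hσj⟩ := exists_perm q i j hij
    set ζ : Fin q → V := fun t => x (σ (Fin.castSucc (Fin.castSucc t))) with hζ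
    obtain ⟨A, hA, hA'⟩ := gF (List.ofFn ζ) (by simp)
    have fil := filippov g hgskew hglie (q + 2) (by omega) htop F hF gF (List.ofFn ζ) (by simp)
    have aD := hF.io (List.ofFn ζ) 2 (by simp; omega)
    have hz : ∀ z : Fin (q + 2) → V, ∑ k, S (Function.update z k (A (z k))) = 0 := by
      intro z
      have h1 := br_act aD A hA' (List.ofFn z) hF
      rw [fil, act_ofFn] at h1
      simp only [hS]
      simpa using h1
    have hsg : ∀ Y Z : V, ⟪A Y, Z⟫ = ((Equiv.Perm.sign σ : ℤ) : ℝ) *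
        S (Function.update (Function.update x i Y) j Z) := by
      intro Y Z
      rw [hA', ← ofFn_snoc, ← hS]
      have h1 : (Fin.snoc (Fin.snoc ζ Y : Fin (q + 1) → V) Z : Fin (q + 2) → V)
          = (Function.update (Function.update x i Y) j Z) ∘ σ := by
        funext t
        refine Fin.lastCases ?_ (fun t => ?_) t
        · simp [hσj]
        · have hne : σ (Fin.castSucc t) ≠ j := by
            rw [← hσj]; intro h
            have := σ.injective h
            simp [Fin.ext_iff] at this
            omega
          simp only [Fin.snoc_castSucc, Function.comp_apply]
          rw [Function.update_of_ne hne]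
          revert hne
          refine Fin.lastCases ?_ (fun t => ?_) t
          · intro _; simp [hσi]
          · intro _
            have hne : σ (Fin.castSucc (Fin.castSucc t)) ≠ i := by
              rw [← hσi]; intro h
              have := σ.injective h
              simp [Fin.ext_iff] at this
              omega
            rw [Function.update_of_ne hne]
            simp [hζ]
      rw [h1, S.map_perm]
      rw [Units.smul_def, zsmul_eq_mul]
    have hs2 : ((Equiv.Perm.sign σ : ℤ) : ℝ) * ((Equiv.Perm.sign σ : ℤ) : ℝ) = 1 := by
      rcases Int.units_eq_one_or (Equiv.Perm.sign σ) with h | h <;> simp [h]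
    refine ⟨((Equiv.Perm.sign σ : ℤ) : ℝ) • A, g.smul_mem _ hA, fun Y Z => ?_, fun z => ?_⟩
    · rw [LinearMap.smul_apply, inner_smul_left, hsg]
      simp only [conj_trivial]
      rw [← mul_assoc, hs2, one_mul]
    · simp only [LinearMap.smul_apply, AlternatingMap.map_update_smul]
      rw [← Finset.smul_sum, hz, smul_zero]

end forms

section rank2
variable {V : Type} [NormedAddCommGroup V] [InnerProductSpace ℝ V] [FiniteDimensional ℝ V]

/-- The elementary skew endomorphism `a ∧ b`. -/
def EE (a b : V) : V →ₗ[ℝ] V :=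
  (innerₛₗ ℝ a).smulRight b - (innerₛₗ ℝ b).smulRight a

lemma EE_apply (a b y : V) : EE a b y = ⟪a, y⟫ • b - ⟪b, y⟫ • a := by
  simp [EE]

lemma EE_add_left (a b c : V) : EE (a + b) c = EE a c + EE b c := by
  ext y; simp only [EE_apply, LinearMap.add_apply, inner_add_left]; module
lemma EE_add_right (a b c : V) : EE c (a + b) = EE c a + EE c b := by
  ext y; simp only [EE_apply, LinearMap.add_apply, inner_add_left]; module
lemma EE_smul_left (r : ℝ) (a c : V) : EE (r • a) c = r • EE a c := by
  ext y; simp only [EE_apply, LinearMap.smul_apply, real_inner_smul_left]; module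
lemma EE_smul_right (r : ℝ) (a c : V) : EE a (r • c) = r • EE a c := by
  ext y; simp only [EE_apply, LinearMap.smul_apply, real_inner_smul_left]; module
lemma EE_swap (a c : V) : EE a c = - EE c a := by
  ext y; simp only [EE_apply, LinearMap.neg_apply]; module
lemma EE_self (a : V) : EE a a = 0 := by
  ext y; simp [EE_apply]
lemma EE_zero_left (a : V) : EE 0 a = 0 := by
  ext y; simp [EE_apply]

lemma EE_lie (A : V →ₗ[ℝ] V) (hA : IsSkew A) (a b : V) :
    A ∘ₗ EE a b - EE a b ∘ₗ A = EE (A a) b + EE a (A b) := by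
  ext y
  have h1 : ⟪A a, y⟫ = - ⟪a, A y⟫ := hA a y
  have h2 : ⟪A b, y⟫ = - ⟪b, A y⟫ := hA b y
  simp only [LinearMap.sub_apply, LinearMap.comp_apply, LinearMap.add_apply, EE_apply, map_sub,
    map_smul, h1, h2]
  module

lemma EE_skew (a b : V) : IsSkew (EE a b) := by
  intro x y
  simp only [EE_apply, inner_sub_left, inner_sub_right, real_inner_smul_left, real_inner_smul_right,
    real_inner_comm x]
  ring

lemma exists_unit_perp (U : Submodule ℝ V) (h3 : 3 ≤ Module.finrank ℝ U) (u w : V) :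
    ∃ v ∈ U, ‖v‖ = 1 ∧ ⟪u, v⟫ = 0 ∧ ⟪w, v⟫ = 0 := by
  let f : U →ₗ[ℝ] (Fin 2 → ℝ) := LinearMap.pi ![(innerₛₗ ℝ u).comp U.subtype,
    (innerₛₗ ℝ w).comp U.subtype]
  have hk : LinearMap.ker f ≠ ⊥ := by
    apply LinearMap.ker_ne_bot_of_finrank_lt
    simp; omega
  obtain ⟨v, hv, hv0⟩ := (Submodule.ne_bot_iff _).1 hk
  have hv' : f v = 0 := hv
  have e1 : ⟪u, (v : V)⟫ = 0 := by simpa [f] using congrFun hv' 0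
  have e2 : ⟪w, (v : V)⟫ = 0 := by simpa [f] using congrFun hv' 1
  have hvn : ‖(v : V)‖ ≠ 0 := by simpa using hv0
  refine ⟨‖(v : V)‖⁻¹ • (v : V), U.smul_mem _ v.2, ?_, ?_, ?_⟩
  · rw [norm_smul]; simp [hvn]
  · rw [real_inner_smul_right, e1, mul_zero]
  · rw [real_inner_smul_right, e2, mul_zero]

lemma full_of_EE (g : Submodule ℝ (V →ₗ[ℝ] V)) (hgskew : ∀ A ∈ g, IsSkew A)
    (hglie : ∀ A ∈ g, ∀ B ∈ g, A ∘ₗ B - B ∘ₗ A ∈ g)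
    (hirr : ∀ W : Submodule ℝ V, (∀ A ∈ g, ∀ x ∈ W, A x ∈ W) → W = ⊥ ∨ W = ⊤)
    (U₀ : Submodule ℝ V) (h3 : 3 ≤ Module.finrank ℝ U₀)
    (hU₀ : ∀ u ∈ U₀, ∀ v ∈ U₀, EE u v ∈ g) (A : V →ₗ[ℝ] V) (hA : IsSkew A) : A ∈ g := by
  -- choose a maximal `U`
  obtain ⟨U, ⟨hU3, hU⟩, hmax⟩ : ∃ U : Submodule ℝ V,
      (3 ≤ Module.finrank ℝ U ∧ ∀ u ∈ U, ∀ v ∈ U, EE u v ∈ g) ∧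
      ∀ U' : Submodule ℝ V, (3 ≤ Module.finrank ℝ U' ∧ ∀ u ∈ U', ∀ v ∈ U', EE u v ∈ g) →
        U ≤ U' → U' ≤ U := by
    have := exists_maximal_of_wellFoundedGT
      (fun U : Submodule ℝ V => 3 ≤ Module.finrank ℝ U ∧ ∀ u ∈ U, ∀ v ∈ U, EE u v ∈ g)
      ⟨U₀, h3, hU₀⟩
    obtain ⟨U, hU⟩ := this
    exact ⟨U, hU.1, fun U' h h' => hU.2 h h'⟩
  have hinv : ∀ A ∈ g, ∀ u ∈ U, A u ∈ U := by
    intro A hA u hu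
    obtain ⟨a, ha, b, hb, hab⟩ := U.exists_add_mem_mem_orthogonal (A u)
    have hb' : ∀ w ∈ U, ⟪w, b⟫ = 0 := fun w hw => hb w hw
    -- perpendicular part
    have key1 : ∀ w ∈ U, ⟪u, w⟫ = 0 → EE b w ∈ g := by
      intro w hw huw
      obtain ⟨v, hv, hv1, huv, hwv⟩ := exists_unit_perp U hU3 u w
      have hvv : ⟪v, v⟫ = 1 := by rw [real_inner_self_eq_norm_sq, hv1]; norm_num
      have X : EE (A u) v + EE u (A v) ∈ g := by
        rw [← EE_lie A (hgskew A hA)]; exact hglie _ hA _ (hU u hu v hv)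
      have Y := hglie _ (hU v hv w hw) _ X
      have e : EE v w ∘ₗ (EE (A u) v + EE u (A v)) - (EE (A u) v + EE u (A v)) ∘ₗ EE v w
          = (EE (EE v w (A u)) v + EE (A u) (EE v w v)) +
            (EE (EE v w u) (A v) + EE u (EE v w (A v))) := by
        rw [← EE_lie _ (EE_skew v w), ← EE_lie _ (EE_skew v w)]
        rw [LinearMap.comp_add, LinearMap.add_comp]; abel
      rw [e] at Y
      have e1 : EE v w v = w := by rw [EE_apply, hvv, hwv]; simp
      have e2 : EE v w u = 0 := by
        rw [EE_apply, real_inner_comm u v, huv, real_inner_comm u w, huw]; simp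
      have hm : ∀ y, EE v w y ∈ U := fun y => by
        rw [EE_apply]; exact U.sub_mem (U.smul_mem _ hw) (U.smul_mem _ hv)
      rw [e1, e2, EE_zero_left, zero_add, hab, EE_add_left a b w] at Y
      have Z := g.sub_mem (g.sub_mem (g.sub_mem Y (hU u hu _ (hm (A v)))) (hU _ (hm (a + b)) v hv))
        (hU a ha w hw)
      convert Z using 1
      abel
    have key2 : EE b u ∈ g := by
      obtain ⟨v, hv, hv1, huv, -⟩ := exists_unit_perp U hU3 u u
      have hvv : ⟪v, v⟫ = 1 := by rw [real_inner_self_eq_norm_sq, hv1]; norm_num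
      have Y := hglie _ (hU v hv u hu) _ (key1 v hv huv)
      rw [EE_lie _ (EE_skew v u)] at Y
      have e1 : EE v u v = u := by rw [EE_apply, hvv, huv]; simp
      have e2 : EE v u b = 0 := by rw [EE_apply, hb' v hv, hb' u hu]; simp
      rwa [e1, e2, EE_zero_left, zero_add] at Y
    have key : ∀ w ∈ U, EE b w ∈ g := by
      intro w hw
      by_cases hu0 : u = 0
      · exact key1 w hw (by simp [hu0])
      have huu : ⟪u, u⟫ ≠ 0 := by simpa using hu0
      have h1 := key1 (w - (⟪u, w⟫ / ⟪u, u⟫) • u) (U.sub_mem hw (U.smul_mem _ hu)) (by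
        rw [inner_sub_right, real_inner_smul_right]; field_simp; ring)
      have h2 := g.add_mem h1 (g.smul_mem (⟪u, w⟫ / ⟪u, u⟫) key2)
      rw [← EE_smul_right, ← EE_add_right] at h2
      simpa using h2
    have hle := hmax (U ⊔ Submodule.span ℝ {b}) ⟨hU3.trans (Submodule.finrank_mono le_sup_left), ?_⟩
      le_sup_left
    · have hbU : b ∈ U := hle (Submodule.mem_sup_right (Submodule.mem_span_singleton_self b))
      rw [hab]; exact U.add_mem ha hbU
    · intro x hx y hy
      obtain ⟨x1, hx1, x2, hx2, rfl⟩ := Submodule.mem_sup.1 hx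
      obtain ⟨y1, hy1, y2, hy2, rfl⟩ := Submodule.mem_sup.1 hy
      obtain ⟨r, rfl⟩ := Submodule.mem_span_singleton.1 hx2
      obtain ⟨s, rfl⟩ := Submodule.mem_span_singleton.1 hy2
      simp only [EE_add_left, EE_add_right, EE_smul_left, EE_smul_right, EE_self]
      refine g.add_mem (g.add_mem (hU _ hx1 _ hy1) (g.smul_mem _ (key _ hy1)))
        (g.smul_mem _ (g.add_mem ?_ ?_))
      · rw [EE_swap]; exact g.neg_mem (key _ hx1)
      · exact g.smul_mem _ g.zero_mem
  have htop : U = ⊤ := by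
    rcases hirr U hinv with h | h
    · rw [h] at hU3; simp at hU3
    · exact h
  have hall : ∀ u v, EE u v ∈ g := fun u v => hU u (by simp [htop]) v (by simp [htop])
  set e := stdOrthonormalBasis ℝ V
  have hsum : A = (1 / 2 : ℝ) • ∑ a, EE (e a) (A (e a)) := by
    ext y
    simp only [LinearMap.smul_apply, LinearMap.sum_apply, EE_apply, Finset.sum_sub_distrib]
    have h1 : ∑ a, ⟪e a, y⟫ • A (e a) = A y := by
      conv_rhs => rw [← e.sum_repr' y]
      simp
    have h2 : ∑ a, ⟪A (e a), y⟫ • e a = - A y := by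
      conv_rhs => rw [← e.sum_repr' (A y)]
      rw [← Finset.sum_neg_distrib]
      refine Finset.sum_congr rfl fun a _ => ?_
      rw [hA, neg_smul]
    rw [h1, h2]; module
  rw [hsum]
  exact g.smul_mem _ (g.sum_mem fun a _ => hall _ _)

end rank2

section frame
variable {V : Type} [NormedAddCommGroup V] [InnerProductSpace ℝ V] [FiniteDimensional ℝ V]

lemma J_zero (p : ℕ) (hp : 4 ≤ p) (J : Fin p → Fin p → V →ₗ[ℝ] V) (μ : ℝ) (hμ : 0 < μ)
    (hskew : ∀ i j, IsSkew (J i j)) (hanti : ∀ i j, J j i = - J i j)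
    (hrel : ∀ i j k, i ≠ j → i ≠ k → j ≠ k → ∀ y,
      J i j (J i k y) - J i k (J i j y) = μ • J j k y)
    (N : Submodule ℝ V) (hN : ∀ i j, ∀ v ∈ N, J i j v ∈ N)
    (hineq : ∀ w : Fin p → V, (∀ i, w i ∈ N) →
      ∑ i, ∑ j, ⟪J i j (w i), w j⟫ ≤ μ * ∑ i, ‖w i‖ ^ 2) (v : V) (hv : v ∈ N) (i j : Fin p) :
    J i j v = 0 := by
  have hJ0 : ∀ i, J i i = 0 := by
    intro i
    ext y
    have h : J i i y = - J i i y := by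
      conv_lhs => rw [hanti i i]
      simp
    have h2 : (2 : ℝ) • J i i y = 0 := by
      rw [two_smul]; nth_rewrite 2 [h]; simp
    simpa using h2
  set n : Fin p → Fin p → ℝ := fun a b => ⟪J a b v, J a b v⟫ with hn
  have hnn : ∀ a b, 0 ≤ n a b := fun a b => real_inner_self_nonneg
  set M : ℝ := ∑ a, ∑ b, n a b with hM
  have key : ∀ i a b, ⟪J a b (J i a v), J i b v⟫
      = μ / 2 * (n i a + n i b - n a b) - if a = b then μ * n i a else 0 := by
    intro i a b
    by_cases hab : a = b
    · subst hab
      simp [hn, hJ0]; ring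
    by_cases hia : i = a
    · subst hia
      simp [hn, hJ0, hab]
    by_cases hib : i = b
    · subst hib
      simp only [hn, hJ0, hanti i a, hab]; simp
    rw [if_neg hab]
    have r1 := hrel i a b hia hib hab v
    have r2 := hrel a b i hab (Ne.symm hia) (Ne.symm hib) v
    have r3 := hrel b i a (Ne.symm hib) (Ne.symm hab) hia v
    rw [hanti i a, hanti i b] at r2
    rw [hanti i b, hanti a b] at r3
    simp only [LinearMap.neg_apply, map_neg, sub_neg_eq_add, neg_neg] at r2 r3
    have e1 : J a b (J i a v) = J i a (J a b v) + μ • J i b v := by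
      have : J a b (J i a v) = J i a (J a b v) - (-J a b (J i a v) + J i a (J a b v)) := by abel
      rw [this, r2]; module
    have e2 : J a b (J i b v) = J i b (J a b v) - μ • J i a v := by
      rw [← r3]; abel
    have e3 : J i a (J i b v) = J i b (J i a v) + μ • J a b v := by
      rw [← r1]; abel
    have s1 : ⟪J a b (J i a v), J i b v⟫ = - ⟪J a b v, J i b (J i a v)⟫ - μ * n a b + μ * n i b := by
      rw [e1, inner_add_left, hskew i a (J a b v), e3, inner_add_right, real_inner_smul_right,
        real_inner_smul_left]
      simp only [hn]; ring
    have s2 : ⟪J a b (J i a v), J i b v⟫ = ⟪J a b v, J i b (J i a v)⟫ + μ * n i a := by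
      rw [hskew a b (J i a v), e2, inner_sub_right, real_inner_smul_right,
        real_inner_comm, hskew i b (J a b v)]
      simp only [hn]; ring
    linarith
  have main : ∀ c : ℝ, 0 < c → ∀ i, 2 * c * ∑ b, n i b + c ^ 2 * ∑ a, ∑ b, ⟪J a b (J i a v), J i b v⟫
      ≤ μ * (‖v‖ ^ 2 + c ^ 2 * ∑ b, n i b) := by
    intro c hc i
    have h := hineq (fun j => (if i = j then v else 0) + c • J i j v)
      (fun j => N.add_mem (by split_ifs; exacts [hv, N.zero_mem]) (N.smul_mem _ (hN _ _ _ hv)))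
    have e1 : ∀ j, ‖(if i = j then v else 0) + c • J i j v‖ ^ 2
        = (if i = j then ‖v‖ ^ 2 else 0) + c ^ 2 * n i j := by
      intro j
      by_cases hij : i = j
      · subst hij; simp [hn, hJ0]
      · simp only [hij, if_false, zero_add, hn]
        rw [norm_smul, mul_pow, real_inner_self_eq_norm_sq]; simp
    have e2 : ∀ a b, ⟪J a b ((if i = a then v else 0) + c • J i a v),
        (if i = b then v else 0) + c • J i b v⟫ = (if i = a then c * n i b else 0)
          + (if i = b then c * n i a else 0) + c ^ 2 * ⟪J a b (J i a v), J i b v⟫ := by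
      intro a b
      have s1 : ⟪J a i (J i a v), v⟫ = n i a := by
        rw [hskew a i, hanti i a]; simp [hn]
      by_cases hia : i = a
      · subst hia
        by_cases hib : i = b
        · subst hib; simp [hJ0, hn]
        · simp [hJ0, hn, hib, real_inner_smul_right]
      · by_cases hib : i = b
        · subst hib
          simp [hJ0, hia, real_inner_smul_left, s1]
        · simp [hia, hib, real_inner_smul_left, real_inner_smul_right]; ring
    simp only [e1, e2, Finset.sum_add_distrib, Finset.sum_ite_eq, ← Finset.mul_sum,
      Finset.mem_univ, if_true] at h
    have e3 : ∑ a, ∑ b, (if i = a then c * n i b else 0) = c * ∑ b, n i b := by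
      rw [Finset.sum_comm]
      simp [Finset.mul_sum]
    rw [e3] at h
    linarith
  have hM0 : 0 ≤ M := Finset.sum_nonneg fun a _ => Finset.sum_nonneg fun b _ => hnn a b
  have hsum : ∑ i, ∑ a, ∑ b, ⟪J a b (J i a v), J i b v⟫ = μ / 2 * (p - 2) * M := by
    simp only [key, Finset.sum_sub_distrib, Finset.sum_add_distrib, ← Finset.mul_sum,
      Finset.sum_ite_eq, Finset.mem_univ, if_true, Finset.sum_const, Finset.card_univ,
      Fintype.card_fin, nsmul_eq_mul]
    rw [← hM]; ring
  have fin : ∀ c : ℝ, 0 < c → 2 * c * M ≤ μ * (p * ‖v‖ ^ 2) := by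
    intro c hc
    have h := Finset.sum_le_sum (s := Finset.univ) fun i _ => main c hc i
    simp only [Finset.sum_add_distrib, ← Finset.mul_sum, Finset.sum_const, Finset.card_univ,
      Fintype.card_fin, nsmul_eq_mul] at h
    rw [hsum, ← hM] at h
    have hp' : (4 : ℝ) ≤ p := by exact_mod_cast hp
    have : 0 ≤ c ^ 2 * μ * M * (p - 4) := by
      have : (0 : ℝ) ≤ p - 4 := by linarith
      positivity
    nlinarith
  have hMz : M = 0 := by
    by_contra hne
    have hMp : 0 < M := lt_of_le_of_ne hM0 (Ne.symm hne)
    have hq : 0 ≤ μ * (p * ‖v‖ ^ 2) := by positivity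
    have := fin ((μ * (p * ‖v‖ ^ 2) + 1) / M) (by positivity)
    have e : 2 * ((μ * (p * ‖v‖ ^ 2) + 1) / M) * M = 2 * (μ * (p * ‖v‖ ^ 2) + 1) := by
      field_simp
    linarith
  have h1 := (Finset.sum_eq_zero_iff_of_nonneg
    (fun a _ => Finset.sum_nonneg fun b _ => hnn a b)).1 hMz i (Finset.mem_univ _)
  have h2 := (Finset.sum_eq_zero_iff_of_nonneg (fun b _ => hnn i b)).1 h1 j (Finset.mem_univ _)
  exact inner_self_eq_zero.1 h2

lemma alt_continuous {p : ℕ} (S : AlternatingMap ℝ V ℝ (Fin p)) : Continuous S := by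
  set e := stdOrthonormalBasis ℝ V
  have h : ∀ z : Fin p → V, S z = ∑ r : Fin p → Fin (Module.finrank ℝ V),
      (∏ i, ⟪e (r i), z i⟫) * S (fun i => e (r i)) := by
    intro z
    have h1 : z = fun i => ∑ a, ⟪e a, z i⟫ • e a := by
      funext i; exact (e.sum_repr' (z i)).symm
    conv_lhs => rw [h1]
    have h2 := S.toMultilinearMap.map_sum (fun i a => ⟪e a, z i⟫ • e a)
    have h3 : ∀ r : Fin p → Fin (Module.finrank ℝ V),
        S.toMultilinearMap (fun i => ⟪e (r i), z i⟫ • e (r i))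
          = (∏ i, ⟪e (r i), z i⟫) * S (fun i => e (r i)) := by
      intro r
      have := S.toMultilinearMap.map_smul_univ (fun i => ⟪e (r i), z i⟫) (fun i => e (r i))
      simpa using this
    simp only [h3] at h2
    exact h2
  have : (S : (Fin p → V) → ℝ) = fun z => ∑ r : Fin p → Fin (Module.finrank ℝ V),
      (∏ i, ⟪e (r i), z i⟫) * S (fun i => e (r i)) := funext h
  rw [this]
  fun_prop

lemma exists_max {p : ℕ} (hp : 0 < p) (S : AlternatingMap ℝ V ℝ (Fin p)) (hS : S ≠ 0) :
    ∃ (x : Fin p → V) (μ : ℝ), 0 < μ ∧ (∀ i, ‖x i‖ = 1) ∧ S x = μ ∧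
      ∀ y : Fin p → V, S y ≤ μ * ∏ i, ‖y i‖ := by
  obtain ⟨z, hz⟩ : ∃ z, 0 < S z := by
    by_contra! hcon
    apply hS
    ext z
    apply le_antisymm (hcon z)
    have h := hcon (Function.update z ⟨0, hp⟩ ((-1 : ℝ) • z ⟨0, hp⟩))
    rw [S.map_update_smul, Function.update_eq_self] at h
    simpa using h
  have hscale : ∀ y : Fin p → V, (∀ i, y i ≠ 0) →
      S y = (∏ i, ‖y i‖) * S (fun i => ‖y i‖⁻¹ • y i) := by
    intro y hy
    have h := S.toMultilinearMap.map_smul_univ (fun i => ‖y i‖) (fun i => ‖y i‖⁻¹ • y i)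
    have e : (fun i => ‖y i‖ • ‖y i‖⁻¹ • y i) = y := by
      funext i; rw [smul_smul, mul_inv_cancel₀ (norm_ne_zero_iff.2 (hy i)), one_smul]
    rw [e] at h
    exact h
  have hunit : ∀ y : Fin p → V, (∀ i, y i ≠ 0) →
      (fun i => ‖y i‖⁻¹ • y i) ∈ Set.pi Set.univ (fun _ : Fin p => Metric.sphere (0 : V) 1) := by
    intro y hy i _
    simp [norm_smul, norm_ne_zero_iff.2 (hy i)]
  have hz0 : ∀ i, z i ≠ 0 := by
    intro i hi
    have := S.map_coord_zero i hi
    linarith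
  have hc : IsCompact (Set.pi Set.univ (fun _ : Fin p => Metric.sphere (0 : V) 1)) :=
    isCompact_univ_pi fun _ => isCompact_sphere 0 1
  obtain ⟨x, hx, hmax⟩ := hc.exists_isMaxOn ⟨_, hunit z hz0⟩ (alt_continuous S).continuousOn
  have hbd : ∀ y : Fin p → V, S y ≤ S x * ∏ i, ‖y i‖ := by
    intro y
    by_cases hy : ∀ i, y i ≠ 0
    · rw [hscale y hy, mul_comm (S x)]
      exact mul_le_mul_of_nonneg_left (hmax (hunit y hy)) (Finset.prod_nonneg fun i _ => norm_nonneg _)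
    · push Not at hy
      obtain ⟨i, hi⟩ := hy
      rw [S.map_coord_zero i hi, Finset.prod_eq_zero (Finset.mem_univ i) (by simp [hi])]
      simp
  refine ⟨x, S x, ?_, fun i => by simpa using hx i trivial, rfl, hbd⟩
  by_contra hneg
  have h1 := hbd z
  have h2 : 0 ≤ ∏ i, ‖z i‖ := Finset.prod_nonneg fun i _ => norm_nonneg _
  nlinarith

lemma first_var {p : ℕ} (S : AlternatingMap ℝ V ℝ (Fin p)) (x : Fin p → V) (μ : ℝ) (hμ : 0 < μ)
    (hx : ∀ i, ‖x i‖ = 1) (hSx : S x = μ) (hbd : ∀ y : Fin p → V, S y ≤ μ * ∏ i, ‖y i‖)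
    (i : Fin p) (y : V) : S (Function.update x i y) = μ * ⟪x i, y⟫ := by
  let f : V →ₗ[ℝ] ℝ := S.toMultilinearMap.toLinearMap x i
  have hf : ∀ y, f y = S (Function.update x i y) := fun y => rfl
  set v := (InnerProductSpace.toDual ℝ V).symm (LinearMap.toContinuousLinearMap f) with hv
  have hfv : ∀ y, ⟪v, y⟫ = f y := by
    intro y; rw [hv, InnerProductSpace.toDual_symm_apply]; rfl
  have hle : ∀ y, f y ≤ μ * ‖y‖ := by
    intro y
    rw [hf]
    refine (hbd _).trans (le_of_eq ?_)
    congr 1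
    rw [← Finset.mul_prod_erase _ _ (Finset.mem_univ i), Function.update_self]
    rw [Finset.prod_eq_one, mul_one]
    intro j hj
    rw [Function.update_of_ne (Finset.ne_of_mem_erase hj), hx]
  have h1 : ‖v‖ ^ 2 ≤ μ * ‖v‖ := by
    rw [← real_inner_self_eq_norm_sq, hfv]; exact hle v
  have h2 : ⟪v, x i⟫ = μ := by rw [hfv, hf, Function.update_eq_self, hSx]
  have h3 : ‖v‖ ≤ μ := by
    by_contra h
    push Not at h
    nlinarith [norm_nonneg v]
  have h4 : v = μ • x i := by
    rw [← sub_eq_zero, ← norm_eq_zero, ← sq_eq_zero_iff]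
    apply le_antisymm _ (sq_nonneg _)
    rw [norm_sub_sq_real, real_inner_smul_right, h2, norm_smul, hx]
    simp only [Real.norm_eq_abs, mul_one, sq_abs]
    nlinarith [norm_nonneg v]
  rw [← hf, ← hfv, h4, real_inner_smul_left]

lemma sum_pairs {p : ℕ} (h : Finset (Fin p) → ℝ) :
    ∑ i, ∑ j, (if i = j then 0 else h {i, j})
      = 2 * ∑ s, (if s.card = 2 then h s else 0) := by
  have h1 : ∑ i, ∑ j, (if i = j then 0 else h {i, j})
      = ∑ q ∈ (Finset.univ : Finset (Fin p)).offDiag, h {q.1, q.2} := by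
    rw [← Finset.sum_product']
    have ho : (Finset.univ : Finset (Fin p)).offDiag
        = ((Finset.univ : Finset (Fin p)) ×ˢ Finset.univ).filter (fun q => q.1 ≠ q.2) := by
      ext q; simp [Finset.mem_offDiag]
    rw [ho, Finset.sum_filter]
    refine Finset.sum_congr rfl fun q _ => ?_
    by_cases hq : q.1 = q.2 <;> simp [hq]
  have h2 : ∑ s ∈ Finset.univ.filter (fun s : Finset (Fin p) => s.card = 2), ∑ _q ∈ s.offDiag, h s
      = ∑ q ∈ (Finset.univ : Finset (Fin p)).offDiag, ∑ s ∈ {({q.1, q.2} : Finset (Fin p))}, h s := by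
    apply Finset.sum_comm'
    intro s q
    simp only [Finset.mem_filter, Finset.mem_univ, true_and, Finset.mem_offDiag,
      Finset.mem_singleton]
    constructor
    · rintro ⟨hs, h1, h2, h3⟩
      refine ⟨?_, h3⟩
      symm
      apply Finset.eq_of_subset_of_card_le
      · intro a ha
        simp only [Finset.mem_insert, Finset.mem_singleton] at ha
        rcases ha with rfl | rfl <;> assumption
      · rw [hs, Finset.card_pair h3]
    · rintro ⟨rfl, h3⟩
      exact ⟨Finset.card_pair h3, by simp, by simp, h3⟩
  simp only [Finset.sum_singleton] at h2
  rw [h1, ← h2, ← Finset.sum_filter, Finset.mul_sum]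
  refine Finset.sum_congr rfl fun s hs => ?_
  simp only [Finset.mem_filter, Finset.mem_univ, true_and] at hs
  rw [Finset.sum_const, Finset.offDiag_card, hs]
  norm_num

lemma second_var {p : ℕ} (S : AlternatingMap ℝ V ℝ (Fin p)) (x : Fin p → V) (μ : ℝ) (hμ : 0 < μ)
    (hx : ∀ i, ‖x i‖ = 1) (hSx : S x = μ) (hbd : ∀ y : Fin p → V, S y ≤ μ * ∏ i, ‖y i‖)
    (w : Fin p → V) (hw : ∀ i, ⟪x i, w i⟫ = 0) :
    ∑ i, ∑ j, (if i = j then 0 else S (Function.update (Function.update x i (w i)) j (w j)))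
      ≤ μ * ∑ i, ‖w i‖ ^ 2 := by
  classical
  set c : Finset (Fin p) → ℝ := fun s => S (s.piecewise w x) with hc
  have hpair : ∀ i j, i ≠ j → S (Function.update (Function.update x i (w i)) j (w j)) = c {i, j} := by
    intro i j hij
    simp only [hc]
    congr 1
    funext k
    by_cases hkj : k = j
    · subst hkj; simp
    · by_cases hki : k = i
      · subst hki; simp [hkj]
      · simp [hkj, hki, Finset.piecewise]
  have h1 : ∑ i, ∑ j, (if i = j then 0 else S (Function.update (Function.update x i (w i)) j (w j)))
      = 2 * ∑ s, (if s.card = 2 then c s else 0) := by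
    rw [← sum_pairs]
    refine Finset.sum_congr rfl fun i _ => Finset.sum_congr rfl fun j _ => ?_
    by_cases hij : i = j
    · simp [hij]
    · rw [if_neg hij, if_neg hij, hpair i j hij]
  rw [h1]
  set q := ∑ s, (if s.card = 2 then c s else 0) with hq
  set C := ∑ i, ‖w i‖ ^ 2 with hC
  have hC0 : 0 ≤ C := Finset.sum_nonneg fun i _ => sq_nonneg _
  set K := ∑ s, |c s| with hK
  have hK0 : 0 ≤ K := Finset.sum_nonneg fun i _ => abs_nonneg _
  -- expansion
  have hexp : ∀ t : ℝ, S (fun i => t • w i + x i) = ∑ s : Finset (Fin p), t ^ s.card * c s := by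
    intro t
    have := S.map_add_univ (fun i => t • w i) x
    have e0 : (fun i => t • w i + x i) = (fun i => t • w i) + x := rfl
    rw [e0, this]
    refine Finset.sum_congr rfl fun s _ => ?_
    have h2 := S.toMultilinearMap.map_piecewise_smul (fun _ => t) (s.piecewise w x) s
    have e1 : s.piecewise (fun i => t • s.piecewise w x i) (s.piecewise w x)
        = s.piecewise (fun i => t • w i) x := by
      funext i
      by_cases hi : i ∈ s <;> simp [hi]
    rw [e1] at h2
    simpa using h2
  have hc1 : ∀ s : Finset (Fin p), s.card = 1 → c s = 0 := by
    intro s hs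
    obtain ⟨i, rfl⟩ := Finset.card_eq_one.1 hs
    simp only [hc, Finset.piecewise_singleton]
    rw [first_var S x μ hμ hx hSx hbd, hw, mul_zero]
  have hlow : ∀ t : ℝ, 0 < t → t ≤ 1 → μ + t ^ 2 * q - t ^ 3 * K ≤ S (fun i => t • w i + x i) := by
    intro t ht ht1
    rw [hexp, hq, hK, Finset.mul_sum, Finset.mul_sum]
    have hμs : μ = ∑ s : Finset (Fin p), if s = ∅ then μ else 0 := by simp
    conv_lhs => rw [hμs]
    rw [← Finset.sum_add_distrib, ← Finset.sum_sub_distrib]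
    refine Finset.sum_le_sum fun s _ => ?_
    have ht3 : 0 ≤ t ^ 3 * |c s| := by positivity
    by_cases h0 : s.card = 0
    · have : s = ∅ := Finset.card_eq_zero.1 h0
      subst this
      have : c ∅ = μ := by simp [hc, hSx]
      simp [this]; positivity
    have hne : s ≠ ∅ := fun h => h0 (by simp [h])
    rw [if_neg hne]
    by_cases h1 : s.card = 1
    · rw [h1, hc1 s h1]; simp
    by_cases h2 : s.card = 2
    · rw [h2]; simp; positivity
    rw [if_neg h2]
    have h3 : 3 ≤ s.card := by omega
    have h4 : t ^ s.card ≤ t ^ 3 := pow_le_pow_of_le_one ht.le ht1 h3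
    have h5 : 0 ≤ t ^ s.card := by positivity
    have h6 : t ^ s.card * (-|c s|) ≤ t ^ s.card * c s :=
      mul_le_mul_of_nonneg_left (neg_abs_le _) h5
    have h7 : t ^ s.card * |c s| ≤ t ^ 3 * |c s| := mul_le_mul_of_nonneg_right h4 (abs_nonneg _)
    linarith
  have hup : ∀ t : ℝ, 0 < t → t ^ 2 * C / 2 ≤ 1 →
      S (fun i => t • w i + x i) ≤ μ * (1 + t ^ 2 * C / 2 + (t ^ 2 * C / 2) ^ 2) := by
    intro t ht htC
    refine (hbd _).trans (mul_le_mul_of_nonneg_left ?_ hμ.le)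
    have e1 : ∀ i, ‖t • w i + x i‖ ≤ Real.exp (t ^ 2 * ‖w i‖ ^ 2 / 2) := by
      intro i
      refine le_trans ?_ (Real.add_one_le_exp _)
      apply le_of_sq_le_sq _ (by positivity)
      rw [norm_add_sq_real, real_inner_smul_left, real_inner_comm, hw, hx, norm_smul, mul_pow]
      simp only [Real.norm_eq_abs, sq_abs]
      nlinarith [sq_nonneg (t ^ 2 * ‖w i‖ ^ 2 / 2)]
    have e2 : ∏ i, ‖t • w i + x i‖ ≤ Real.exp (t ^ 2 * C / 2) := by
      have : t ^ 2 * C / 2 = ∑ i, t ^ 2 * ‖w i‖ ^ 2 / 2 := by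
        rw [hC, Finset.mul_sum, Finset.sum_div]
      rw [this, Real.exp_sum]
      exact Finset.prod_le_prod (fun i _ => norm_nonneg _) fun i _ => e1 i
    have e3 : 0 ≤ t ^ 2 * C / 2 := by positivity
    have e4 := Real.abs_exp_sub_one_sub_id_le (x := t ^ 2 * C / 2) (by rw [abs_of_nonneg e3]; exact htC)
    have e5 := (abs_le.1 e4).2
    linarith
  -- conclusion
  by_contra hcon
  push Not at hcon
  set δ := 2 * q - μ * C with hδ
  have hδ0 : 0 < δ := by linarith
  have hcomb : ∀ t : ℝ, 0 < t → t ≤ 1 → t ^ 2 * C / 2 ≤ 1 → δ ≤ t * (2 * K + μ * C ^ 2 / 2) := by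
    intro t ht ht1 htC
    have h1 := (hlow t ht ht1).trans (hup t ht htC)
    have ht2 : 0 < t ^ 2 := by positivity
    have h2 : t ^ 2 * δ ≤ t ^ 2 * (t * (2 * K) + t ^ 2 * (μ * C ^ 2 / 2)) := by
      rw [hδ]; nlinarith
    have h3 := le_of_mul_le_mul_left h2 ht2
    have h4 : t ^ 2 * (μ * C ^ 2 / 2) ≤ t * (μ * C ^ 2 / 2) := by
      apply mul_le_mul_of_nonneg_right _ (by positivity)
      nlinarith
    linarith
  set L := 2 * K + μ * C ^ 2 / 2 with hL
  have hL0 : 0 ≤ L := by positivity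
  set t := min (1 / (1 + C)) (δ / (2 * (L + 1))) with ht
  have htp : 0 < t := lt_min (by positivity) (by positivity)
  have ht1 : t ≤ 1 / (1 + C) := min_le_left _ _
  have ht2 : t ≤ δ / (2 * (L + 1)) := min_le_right _ _
  have ht1' : t * (1 + C) ≤ 1 := by rwa [le_div_iff₀ (by positivity)] at ht1
  have ht2' : t * (2 * (L + 1)) ≤ δ := by rwa [le_div_iff₀ (by positivity)] at ht2
  have htle : t ≤ 1 := by nlinarith
  have := hcomb t htp htle (by nlinarith [mul_nonneg htp.le hC0])
  nlinarith [mul_nonneg htp.le hL0]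

end frame

section final
variable {V : Type} [NormedAddCommGroup V] [InnerProductSpace ℝ V] [FiniteDimensional ℝ V]

lemma all_mem (g : Submodule ℝ (V →ₗ[ℝ] V))
    (hgskew : ∀ A ∈ g, IsSkew A)
    (hglie : ∀ A ∈ g, ∀ B ∈ g, A ∘ₗ B - B ∘ₗ A ∈ g)
    (hirr : ∀ W : Submodule ℝ V, (∀ A ∈ g, ∀ x ∈ W, A x ∈ W) → W = ⊥ ∨ W = ⊤)
    (p : ℕ) (hp : 4 ≤ p) (S : AlternatingMap ℝ V ℝ (Fin p)) (hS : S ≠ 0)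
    (hall : ∀ (x : Fin p → V) (i j : Fin p), i ≠ j → ∃ A ∈ g,
      (∀ Y Z, ⟪A Y, Z⟫ = S (Function.update (Function.update x i Y) j Z)) ∧
      ∀ z : Fin p → V, ∑ k, S (Function.update z k (A (z k))) = 0)
    (A : V →ₗ[ℝ] V) (hA : IsSkew A) : A ∈ g := by
  obtain ⟨x, μ, hμ, hx, hSx, hbd⟩ := exists_max (by omega) S hS
  have hfv := first_var S x μ hμ hx hSx hbd
  have horth : ∀ i j, i ≠ j → ⟪x i, x j⟫ = 0 := by
    intro i j hij
    have h := hfv i (x j)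
    rw [S.map_eq_zero_of_eq (i := i) (j := j) _ (by simp [Function.update_of_ne (Ne.symm hij)]) hij] at h
    rcases mul_eq_zero.1 h.symm with h | h
    · exact absurd h hμ.ne'
    · exact h
  have hex : ∀ i j : Fin p, ∃ A ∈ g, (i = j → A = 0) ∧ (i ≠ j →
      (∀ Y Z, ⟪A Y, Z⟫ = S (Function.update (Function.update x i Y) j Z)) ∧
      ∀ z : Fin p → V, ∑ k, S (Function.update z k (A (z k))) = 0) := by
    intro i j
    by_cases hij : i = j
    · exact ⟨0, g.zero_mem, fun _ => rfl, fun h => absurd hij h⟩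
    · obtain ⟨A, hA, h⟩ := hall x i j hij
      exact ⟨A, hA, fun h => absurd h hij, fun _ => h⟩
  choose J hJg hJ0 hJ using hex
  have hskew : ∀ i j, IsSkew (J i j) := fun i j => hgskew _ (hJg i j)
  have hin : ∀ i j, i ≠ j → ∀ Y Z, ⟪J i j Y, Z⟫
      = S (Function.update (Function.update x i Y) j Z) := fun i j h => (hJ i j h).1
  have hfil : ∀ i j, i ≠ j → ∀ z : Fin p → V, ∑ k, S (Function.update z k (J i j (z k))) = 0 :=
    fun i j h => (hJ i j h).2
  have hanti : ∀ i j, J j i = - J i j := by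
    intro i j
    by_cases hij : i = j
    · subst hij; simp [hJ0 i i rfl]
    · ext y
      refine ext_inner_right ℝ fun z => ?_
      rw [LinearMap.neg_apply, inner_neg_left, hskew i j y z, neg_neg, real_inner_comm (J i j z) y,
        hin i j hij, hin j i (Ne.symm hij), Function.update_comm (Ne.symm hij)]
  have hJi : ∀ i j, i ≠ j → J i j (x i) = μ • x j := by
    intro i j hij
    refine ext_inner_right ℝ fun z => ?_
    rw [hin i j hij, Function.update_eq_self, hfv, real_inner_smul_left]
  have hJj : ∀ i j, i ≠ j → J i j (x j) = - (μ • x i) := by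
    intro i j hij
    rw [hanti j i, LinearMap.neg_apply, hJi j i (Ne.symm hij)]
  have hJl : ∀ i j l, l ≠ i → l ≠ j → J i j (x l) = 0 := by
    intro i j l hli hlj
    by_cases hij : i = j
    · simp [hJ0 i j hij]
    refine ext_inner_right ℝ fun z => ?_
    rw [hin i j hij, inner_zero_left]
    refine S.map_eq_zero_of_eq (i := i) (j := l) _ ?_ (Ne.symm hli)
    simp [Function.update_of_ne, hli, hlj, hij]
  have hrel : ∀ i j k, i ≠ j → i ≠ k → j ≠ k → ∀ y,
      J i j (J i k y) - J i k (J i j y) = μ • J j k y := by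
    intro i j k hij hik hjk y
    refine ext_inner_right ℝ fun u => ?_
    set z : Fin p → V := Function.update (Function.update x i y) k u with hz
    have hzi : z i = y := by simp [hz, Function.update_of_ne hik]
    have hzk : z k = u := by simp [hz]
    have hzl : ∀ l, l ≠ i → l ≠ k → z l = x l := by
      intro l h1 h2; simp [hz, Function.update_of_ne h1, Function.update_of_ne h2]
    have hsum := hfil i j hij z
    rw [← Finset.sum_subset (Finset.subset_univ ({i, j, k} : Finset (Fin p)))] at hsum
    swap
    · intro l _ hl
      simp only [Finset.mem_insert, Finset.mem_singleton, not_or] at hl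
      rw [hzl l hl.1 hl.2.2, hJl i j l hl.1 hl.2.1]
      exact S.map_update_zero z l
    rw [Finset.sum_insert (by simp [hij, hik]), Finset.sum_insert (by simp [hjk]),
      Finset.sum_singleton, hzi, hzk, hzl j (Ne.symm hij) hjk, hJj i j hij] at hsum
    have t1 : S (Function.update z i (J i j y)) = ⟪J i k (J i j y), u⟫ := by
      rw [hin i k hik, hz, Function.update_comm hik, Function.update_idem, Function.update_comm hik]
    have t3 : S (Function.update z k (J i j u)) = - ⟪J i j (J i k y), u⟫ := by
      rw [hskew i j, neg_neg, hin i k hik, hz, Function.update_idem]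
    have t2 : S (Function.update z j (-(μ • x i))) = μ * ⟪J j k y, u⟫ := by
      rw [← neg_smul, S.map_update_smul, hin j k hjk]
      have h := S.map_swap (Function.update z j (x i)) hij
      have e : (Function.update z j (x i)) ∘ (Equiv.swap i j)
          = Function.update (Function.update x j y) k u := by
        funext l
        simp only [Function.comp]
        by_cases hli : l = i
        · subst hli; simp [Function.update_of_ne hij, Function.update_of_ne hik]
        by_cases hlj : l = j
        · subst hlj
          simp [Function.update_of_ne hij, Function.update_of_ne hjk, hzi]
        rw [Equiv.swap_apply_of_ne_of_ne hli hlj, Function.update_of_ne hlj]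
        by_cases hlk : l = k
        · subst hlk; simp [hz]
        · rw [hzl l hli hlk]; simp [Function.update_of_ne hlk, Function.update_of_ne hlj]
      rw [e] at h
      rw [h]; simp
    rw [t1, t2, t3] at hsum
    rw [inner_sub_left, real_inner_smul_left]
    linarith
  set U₀ : Submodule ℝ V := Submodule.span ℝ (Set.range x) with hU
  have hNmem : ∀ v, v ∈ U₀ᗮ ↔ ∀ i, ⟪x i, v⟫ = 0 := by
    intro v
    rw [Submodule.mem_orthogonal]
    constructor
    · intro h i; exact h _ (Submodule.subset_span ⟨i, rfl⟩)
    · intro h u hu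
      induction hu using Submodule.span_induction with
      | mem u hu => obtain ⟨i, rfl⟩ := hu; exact h i
      | zero => simp
      | add a b _ _ ha hb => rw [inner_add_left, ha, hb, add_zero]
      | smul c a _ ha => rw [real_inner_smul_left, ha, mul_zero]
  have hN : ∀ i j, ∀ v ∈ U₀ᗮ, J i j v ∈ U₀ᗮ := by
    intro i j v hv
    rw [hNmem] at hv ⊢
    intro l
    have h0 := hskew i j (x l) v
    have h1 : ⟪J i j (x l), v⟫ = 0 := by
      by_cases hij : i = j
      · simp [hJ0 i j hij]
      by_cases hli : l = i
      · rw [hli, hJi i j hij, real_inner_smul_left, hv, mul_zero]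
      by_cases hlj : l = j
      · rw [hlj, hJj i j hij, inner_neg_left, real_inner_smul_left, hv]; simp
      · rw [hJl i j l hli hlj, inner_zero_left]
    linarith
  have hineq : ∀ w : Fin p → V, (∀ i, w i ∈ U₀ᗮ) →
      ∑ i, ∑ j, ⟪J i j (w i), w j⟫ ≤ μ * ∑ i, ‖w i‖ ^ 2 := by
    intro w hw
    refine le_trans (le_of_eq ?_)
      (second_var S x μ hμ hx hSx hbd w fun i => (hNmem _).1 (hw i) i)
    refine Finset.sum_congr rfl fun i _ => Finset.sum_congr rfl fun j _ => ?_
    by_cases hij : i = j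
    · rw [hJ0 i j hij, if_pos hij]; simp
    · rw [if_neg hij, hin i j hij]
  have hzero := J_zero p hp J μ hμ hskew hanti hrel U₀ᗮ hN hineq
  have hEE : ∀ i j, EE (x i) (x j) ∈ g := by
    intro i j
    by_cases hij : i = j
    · rw [hij, EE_self]; exact g.zero_mem
    have hself : ∀ l, ⟪x l, x l⟫ = 1 := by
      intro l; rw [real_inner_self_eq_norm_sq, hx]; norm_num
    have heq : J i j = μ • EE (x i) (x j) := by
      have hU1 : ∀ u ∈ U₀, J i j u = (μ • EE (x i) (x j)) u := by
        intro u hu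
        induction hu using Submodule.span_induction with
        | mem u hu =>
          obtain ⟨l, rfl⟩ := hu
          rw [LinearMap.smul_apply, EE_apply]
          by_cases hli : l = i
          · rw [hli, hJi i j hij, hself, horth j i (Ne.symm hij)]; simp
          by_cases hlj : l = j
          · rw [hlj, hJj i j hij, hself, horth i j hij]; simp
          · rw [hJl i j l hli hlj, horth i l (Ne.symm hli), horth j l (Ne.symm hlj)]; simp
        | zero => simp
        | add a b _ _ ha hb => rw [map_add, map_add, ha, hb]
        | smul c a _ ha => rw [map_smul, map_smul, ha]
      ext y
      obtain ⟨u, hu, v, hv, rfl⟩ := U₀.exists_add_mem_mem_orthogonal y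
      rw [map_add, map_add, hU1 u hu, hzero v hv i j, LinearMap.smul_apply _ _ v, EE_apply,
        (hNmem v).1 hv, (hNmem v).1 hv]
      simp
    have : EE (x i) (x j) = μ⁻¹ • J i j := by
      rw [heq, smul_smul, inv_mul_cancel₀ hμ.ne', one_smul]
    rw [this]
    exact g.smul_mem _ (hJg i j)
  have hEE1 : ∀ i, ∀ v ∈ U₀, EE (x i) v ∈ g := by
    intro i v hv
    induction hv using Submodule.span_induction with
    | mem u hu => obtain ⟨l, rfl⟩ := hu; exact hEE i l
    | zero =>
      have : EE (x i) (0 : V) = 0 := by ext y; simp [EE_apply]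
      rw [this]; exact g.zero_mem
    | add a b _ _ ha hb => rw [EE_add_right]; exact g.add_mem ha hb
    | smul c a _ ha => rw [EE_smul_right]; exact g.smul_mem _ ha
  have hEE2 : ∀ u ∈ U₀, ∀ v ∈ U₀, EE u v ∈ g := by
    intro u hu v hv
    induction hu using Submodule.span_induction with
    | mem u hu => obtain ⟨l, rfl⟩ := hu; exact hEE1 l v hv
    | zero => rw [EE_zero_left]; exact g.zero_mem
    | add a b _ _ ha hb => rw [EE_add_left]; exact g.add_mem ha hb
    | smul c a _ ha => rw [EE_smul_left]; exact g.smul_mem _ ha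
  have hon : Orthonormal ℝ x := ⟨hx, fun i j hij => horth i j hij⟩
  have hfr : Module.finrank ℝ U₀ = p := by
    rw [hU, finrank_span_eq_card hon.linearIndependent, Fintype.card_fin]
  exact full_of_EE g hgskew hglie hirr U₀ (by omega) hEE2 A hA

end final

end SkewProl

/-- `Λᵖ V ∩ (Λ^{p-2} V ⊗ g) = {0}` for `4 ≤ p ≤ n`, where `p = m + 2`. -/
theorem stmt_1
    (g : Submodule ℝ (V →ₗ[ℝ] V))
    (hgskew : ∀ A ∈ g, IsSkew A)
    (hglie : ∀ A ∈ g, ∀ B ∈ g, A ∘ₗ B - B ∘ₗ A ∈ g)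
    (hproper : ∃ A : V →ₗ[ℝ] V, IsSkew A ∧ A ∉ g)
    (hirr : ∀ W : Submodule ℝ V, (∀ A ∈ g, ∀ x ∈ W, A x ∈ W) → W = ⊥ ∨ W = ⊤)
    (m : ℕ) (hp4 : 4 ≤ m + 2) (hpn : m + 2 ≤ Module.finrank ℝ V)
    (T : AlternatingMap ℝ V ℝ (Fin (m + 2)))
    (hT : ∀ ζ : Fin m → V, ∃ A ∈ g, ∀ Y Z : V,
      ⟪A Y, Z⟫ = T (Fin.snoc (Fin.snoc ζ Y) Z)) :
    T = 0 := by
  by_contra hT0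
  obtain ⟨p, hp, S, hS, hall⟩ := SkewProl.exists_top g hgskew hglie m hp4 T hT hT0
  obtain ⟨A, hA, hAg⟩ := hproper
  exact hAg (SkewProl.all_mem g hgskew hglie hirr p hp S hS hall A hA)
end
end

section
/- Let T ≠ 0 in ΛᵖV with p ≥ 4 satisfy the Plücker-type relations. Then T is decomposable: there exist pairwise orthogonal p-dimensional subspaces V₁,…,V_d of V and nonzero p-forms T₁,…,T_d with T = Σₖ Tₖ, where each Tₖ vanishes whenever one of its arguments is orthogonal to Vₖ (so each Tₖ is a simple p-form, a multiple of a volume form of Vₖ). -/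
open scoped RealInnerProductSpace BigOperators

noncomputable section

variable {V : Type} [NormedAddCommGroup V] [InnerProductSpace ℝ V] [FiniteDimensional ℝ V]

/-- The Plücker-type relations for a `(m+2)`-form `T`: for all `ζ₁,…,ζ_m ∈ V`, the
skew endomorphism `F` dual to the 2-form `ζ₁⌟⋯⌟ζ_m⌟T` annihilates `T` under the
natural `so(V)`-action on forms. -/
def PluckerRel {m : ℕ} (T : AlternatingMap ℝ V ℝ (Fin (m + 2))) : Prop :=
  ∀ ζ : Fin m → V, ∃ F : V →ₗ[ℝ] V,
    (∀ Y Z : V, ⟪F Y, Z⟫ = T (Fin.snoc (Fin.snoc ζ Y) Z)) ∧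
    (∀ X : Fin (m + 2) → V, ∑ j, T (Function.update X j (F (X j))) = 0)

set_option linter.unusedSectionVars false

theorem riesz_eq (w e : V) (l c : ℝ) (hb : ∀ x, ⟪w, x⟫ ≤ l * ‖x‖) (he : ‖e‖ = 1)
    (hc : ⟪w, e⟫ = c) (hl : |c| = l) : w = c • e := by
  have h1 : ‖w‖ ≤ l := by
    have := hb w
    rw [real_inner_self_eq_norm_sq] at this
    by_contra h
    push Not at h
    have : 0 < ‖w‖ := lt_of_le_of_lt (by rw [← hl]; positivity) h
    nlinarith
  have h2 : ‖w - c • e‖ ^ 2 ≤ 0 := by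
    rw [norm_sub_sq_real, inner_smul_right, hc, norm_smul, he]
    have h3 : ‖w‖ ^ 2 ≤ l ^ 2 := by gcongr
    rw [← hl, sq_abs] at h3
    simp only [Real.norm_eq_abs, mul_one, sq_abs]
    nlinarith
  have h3 : ‖w - c • e‖ = 0 := by nlinarith [norm_nonneg (w - c • e)]
  exact sub_eq_zero.mp (norm_eq_zero.mp h3)

theorem triple_id (x y z : V →ₗ[ℝ] V) (l : ℝ)
    (hx : ∀ a b, ⟪x a, b⟫ = -⟪a, x b⟫) (hy : ∀ a b, ⟪y a, b⟫ = -⟪a, y b⟫)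
    (hz : ∀ a b, ⟪z a, b⟫ = -⟪a, z b⟫)
    (hxz : ∀ a, x (z a) = z (x a) + l • y a)
    (hyx : ∀ a, y (x a) = x (y a) + l • z a)
    (hzy : ∀ a, z (y a) = y (z a) + l • x a) (u : V) :
    ⟪y (x u), z u⟫ = l / 2 * (‖x u‖ ^ 2 + ‖z u‖ ^ 2 - ‖y u‖ ^ 2) := by
  have h1 : ⟪y (x u), z u⟫ = -⟪y u, z (x u)⟫ - l * ‖y u‖ ^ 2 + l * ‖z u‖ ^ 2 := by
    rw [hyx, inner_add_left, hx, hxz, inner_add_right, inner_smul_right, inner_smul_left,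
      real_inner_self_eq_norm_sq, real_inner_self_eq_norm_sq]
    simp; ring
  have h2 : ⟪y (x u), z u⟫ = ⟪y u, z (x u)⟫ + l * ‖x u‖ ^ 2 := by
    have : y (z u) = z (y u) - l • x u := by rw [hzy]; simp
    rw [hy, this, inner_sub_right, inner_smul_right, real_inner_self_eq_norm_sq,
      real_inner_comm, hz, real_inner_comm (z (x u)) (y u)]
    ring
  linarith

/-- abstract 4-form data -/
structure Four (A : V → V → V →ₗ[ℝ] V) (l : ℝ) : Prop where
  s12 : ∀ a b c d, ⟪A b a c, d⟫ = -⟪A a b c, d⟫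
  s23 : ∀ a b c d, ⟪A a c b, d⟫ = -⟪A a b c, d⟫
  s34 : ∀ a b c d, ⟪A a b d, c⟫ = -⟪A a b c, d⟫
  der : ∀ a b x y z w, ⟪A (A a b x) y z, w⟫ + ⟪A x (A a b y) z, w⟫ + ⟪A x y (A a b z), w⟫
      + ⟪A x y z, A a b w⟫ = 0
  bd : ∀ a b c d, ⟪A a b c, d⟫ ≤ l * (‖a‖ * ‖b‖ * ‖c‖ * ‖d‖)
  pos : 0 < l

namespace Four
variable {A : V → V → V →ₗ[ℝ] V} {l : ℝ}

theorem swap12 (h : Four A l) (a b : V) : A b a = - A a b := by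
  ext c
  apply ext_inner_right ℝ
  intro d
  simp [h.s12 a b]

theorem pair (h : Four A l) (a b c d : V) : ⟪A a b c, d⟫ = ⟪A c d a, b⟫ := by
  rw [h.s23 a c b d, h.s12 c a b d, h.s34 c a d b, h.s23 c d a b]; ring

theorem add1 (h : Four A l) (a a' b : V) : A (a + a') b = A a b + A a' b := by
  ext c
  apply ext_inner_right ℝ
  intro d
  rw [h.pair, map_add, inner_add_left, LinearMap.add_apply, inner_add_left, h.pair a, h.pair a']

theorem smul1 (h : Four A l) (t : ℝ) (a b : V) : A (t • a) b = t • A a b := by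
  ext c
  apply ext_inner_right ℝ
  intro d
  rw [h.pair, map_smul, inner_smul_left, LinearMap.smul_apply, inner_smul_left, h.pair a]

theorem add2 (h : Four A l) (a b b' : V) : A a (b + b') = A a b + A a b' := by
  rw [h.swap12, h.add1, h.swap12 a b, h.swap12 a b']; abel

theorem smul2 (h : Four A l) (t : ℝ) (a b : V) : A a (t • b) = t • A a b := by
  rw [h.swap12, h.smul1, h.swap12 a b]; simp

theorem self1 (h : Four A l) (a c : V) : A a a c = 0 := by
  apply ext_inner_right ℝ
  intro d
  have := h.s12 a a c d
  rw [inner_zero_left]; linarith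

theorem self2 (h : Four A l) (a b : V) : A a b b = 0 := by
  apply ext_inner_right ℝ
  intro d
  have := h.s23 a b b d
  rw [inner_zero_left]; linarith

theorem self3 (h : Four A l) (a b : V) : A a b a = 0 := by
  rw [h.swap12]; simp [h.self2]

theorem skew (h : Four A l) (a b c d : V) : ⟪A a b c, d⟫ = -⟪c, A a b d⟫ := by
  rw [h.s34 a b d c, real_inner_comm]

theorem comm (h : Four A l) (a b c d y : V) : A a b (A c d y) =
    A c d (A a b y) + A (A a b c) d y + A c (A a b d) y := by
  apply ext_inner_right ℝ
  intro z
  have h1 := h.der a b c d y z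
  have h2 := h.skew a b (A c d y) z
  simp only [inner_add_left]
  linarith

end Four

/-- positively oriented maximizer -/
def Mx (A : V → V → V →ₗ[ℝ] V) (l : ℝ) (a b c d : V) : Prop :=
  ‖a‖ = 1 ∧ ‖b‖ = 1 ∧ ‖c‖ = 1 ∧ ‖d‖ = 1 ∧ ⟪A a b c, d⟫ = l

namespace Four
variable {A : V → V → V →ₗ[ℝ] V} {l : ℝ}

theorem rot (h : Four A l) {a b c d : V} (m : Mx A l a b c d) : Mx A l b c a d := by
  obtain ⟨h1, h2, h3, h4, h5⟩ := m
  refine ⟨h2, h3, h1, h4, ?_⟩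
  rw [h.s23 b a c d, h.s12 a b c d, h5]; ring

theorem dsw (h : Four A l) {a b c d : V} (m : Mx A l a b c d) : Mx A l b a d c := by
  obtain ⟨h1, h2, h3, h4, h5⟩ := m
  refine ⟨h2, h1, h4, h3, ?_⟩
  rw [h.s12 a b d c, h.s34 a b c d, h5]; ring

theorem val (h : Four A l) {a b c d : V} (m : Mx A l a b c d) : A a b c = l • d := by
  obtain ⟨h1, h2, h3, h4, h5⟩ := m
  refine riesz_eq _ _ l _ (fun x => ?_) h4 h5 (abs_of_pos h.pos)
  have := h.bd a b c x
  simpa [h1, h2, h3] using this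

theorem ineq (h : Four A l) {a b c d : V} (m : Mx A l a b c d) (p q r s : V)
    (hp : ⟪a, p⟫ = 0) (hq : ⟪b, q⟫ = 0) (hr : ⟪c, r⟫ = 0) (hs : ⟪d, s⟫ = 0) :
    ⟪A c d p, q⟫ + ⟪A d b p, r⟫ + ⟪A b c p, s⟫ + ⟪A a d q, r⟫ + ⟪A c a q, s⟫ + ⟪A a b r, s⟫
      ≤ l / 2 * (‖p‖ ^ 2 + ‖q‖ ^ 2 + ‖r‖ ^ 2 + ‖s‖ ^ 2) := by
  have key : ∀ (e x : V) (t : ℝ), ‖e‖ = 1 → ⟪e, x⟫ = 0 →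
      ‖e + t • x‖ ≤ 1 + t ^ 2 * (‖x‖ ^ 2 / 2) := by
    intro e x t he hx
    have h1 : ‖e + t • x‖ ^ 2 = 1 + t ^ 2 * ‖x‖ ^ 2 := by
      rw [norm_add_sq_real, inner_smul_right, hx, he, norm_smul, mul_pow, Real.norm_eq_abs, sq_abs]
      ring
    refine (sq_le_sq₀ (norm_nonneg _) (by positivity)).mp ?_
    rw [h1]
    nlinarith [sq_nonneg (t ^ 2 * (‖x‖ ^ 2 / 2))]
  have va := h.val (h.dsw (h.rot m))
  have vb := h.val (h.dsw (h.rot (h.rot m)))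
  have vc := h.val (h.dsw m)
  have vd := h.val m
  have e1 : ⟪A p b c, d⟫ = 0 := by
    rw [h.s12 b p c d, h.s23 b c p d, h.s34 b c d p, h.s12 c b d p, va, inner_smul_left, hp]; simp
  have e2 : ⟪A a q c, d⟫ = 0 := by
    rw [h.s23 a c q d, h.s34 a c d q, vb, inner_smul_left, hq]; simp
  have e3 : ⟪A a b r, d⟫ = 0 := by
    rw [h.s34 a b d r, h.s12 b a d r, vc, inner_smul_left, hr]; simp
  have e4 : ⟪A a b c, s⟫ = 0 := by
    rw [vd, inner_smul_left, hs]; simp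
  obtain ⟨ha, hb, hc, hd, h5⟩ := m
  set B := ⟪A a q r, s⟫ + ⟪A p b r, s⟫ + ⟪A p q c, s⟫ + ⟪A p q r, d⟫ with hB
  set D := ⟪A p q r, s⟫ with hD
  set Q := ⟪A c d p, q⟫ + ⟪A d b p, r⟫ + ⟪A b c p, s⟫ + ⟪A a d q, r⟫ + ⟪A c a q, s⟫ + ⟪A a b r, s⟫
    with hQ
  have q1 : ⟪A c d p, q⟫ = ⟪A p q c, d⟫ := h.pair _ _ _ _
  have q2 : ⟪A d b p, r⟫ = ⟪A p b r, d⟫ := by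
    rw [h.s12 b d, h.pair b d, h.s23 p b r, h.s34 p b d r]; ring
  have q3 : ⟪A b c p, s⟫ = ⟪A p b c, s⟫ := by
    rw [h.s23 b p c, h.s12 p b]; ring
  have q4 : ⟪A a d q, r⟫ = ⟪A a q r, d⟫ := by
    rw [h.s23 a q d r, h.s34 a q r d]; ring
  have q5 : ⟪A c a q, s⟫ = ⟪A a q c, s⟫ := by
    rw [h.s12 a c q, h.s23 a q c]; ring
  have main : ∀ t : ℝ, 0 < t → Q + t * B + t ^ 2 * D ≤
      l * ((‖p‖ ^ 2 / 2 + ‖q‖ ^ 2 / 2 + ‖r‖ ^ 2 / 2 + ‖s‖ ^ 2 / 2)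
       + t ^ 2 * (‖p‖ ^ 2 / 2 * (‖q‖ ^ 2 / 2) + ‖p‖ ^ 2 / 2 * (‖r‖ ^ 2 / 2)
         + ‖p‖ ^ 2 / 2 * (‖s‖ ^ 2 / 2) + ‖q‖ ^ 2 / 2 * (‖r‖ ^ 2 / 2)
         + ‖q‖ ^ 2 / 2 * (‖s‖ ^ 2 / 2) + ‖r‖ ^ 2 / 2 * (‖s‖ ^ 2 / 2))
       + t ^ 4 * (‖p‖ ^ 2 / 2 * (‖q‖ ^ 2 / 2) * (‖r‖ ^ 2 / 2)
         + ‖p‖ ^ 2 / 2 * (‖q‖ ^ 2 / 2) * (‖s‖ ^ 2 / 2)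
         + ‖p‖ ^ 2 / 2 * (‖r‖ ^ 2 / 2) * (‖s‖ ^ 2 / 2)
         + ‖q‖ ^ 2 / 2 * (‖r‖ ^ 2 / 2) * (‖s‖ ^ 2 / 2))
       + t ^ 6 * (‖p‖ ^ 2 / 2 * (‖q‖ ^ 2 / 2) * (‖r‖ ^ 2 / 2) * (‖s‖ ^ 2 / 2))) := by
    intro t ht
    have h1 := h.bd (a + t • p) (b + t • q) (c + t • r) (d + t • s)
    have h2 : ‖a + t • p‖ * ‖b + t • q‖ * ‖c + t • r‖ * ‖d + t • s‖ ≤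
        (1 + t ^ 2 * (‖p‖ ^ 2 / 2)) * (1 + t ^ 2 * (‖q‖ ^ 2 / 2)) * (1 + t ^ 2 * (‖r‖ ^ 2 / 2))
          * (1 + t ^ 2 * (‖s‖ ^ 2 / 2)) := by
      gcongr
      · exact key a p t ha hp
      · exact key b q t hb hq
      · exact key c r t hc hr
      · exact key d s t hd hs
    have h3 := h1.trans (mul_le_mul_of_nonneg_left h2 h.pos.le)
    have h4 : ⟪A (a + t • p) (b + t • q) (c + t • r), d + t • s⟫ =
        l + t ^ 2 * Q + t ^ 3 * B + t ^ 4 * D := by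
      rw [hQ, q1, q2, q3, q4, q5]
      simp only [h.add1, h.add2, h.smul1, h.smul2, map_add, map_smul, LinearMap.add_apply,
        LinearMap.smul_apply, inner_add_left, inner_add_right, inner_smul_left, inner_smul_right,
        smul_add, conj_trivial, e1, e2, e3, e4, h5, hB, hD]
      ring
    rw [h4] at h3
    refine le_of_mul_le_mul_left (a := t ^ 2) ?_ (by positivity)
    refine le_trans (le_of_eq ?_) ((sub_le_sub_right h3 l).trans (le_of_eq ?_)) <;> ring
  have lim := ContinuousWithinAt.closure_le (s := Set.Ioi (0 : ℝ)) (x := 0)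
    (f := fun t => Q + t * B + t ^ 2 * D) (g := _) (by simp) (by fun_prop) ?_ main
  · refine le_trans (le_of_eq ?_) (lim.trans (le_of_eq ?_)) <;> ring
  · fun_prop

theorem sw23 (h : Four A l) (a b c : V) : A a c b = - A a b c := by
  apply ext_inner_right ℝ
  intro d
  simp [h.s23 a b c d]

theorem tri (h : Four A l) {a b c d : V} (m : Mx A l a b c d) (u : V) :
    ⟪A a d (A c d u), A d b u⟫ = l / 2 * (‖A c d u‖ ^ 2 + ‖A d b u‖ ^ 2 - ‖A a d u‖ ^ 2) := by
  have va : A c d b = - (l • a) := by rw [h.sw23 c b d, h.val (h.dsw (h.rot m))]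
  have vb : A a d c = - (l • b) := by rw [h.sw23 a c d, h.val (h.dsw (h.rot (h.rot m)))]
  have vc : A d b a = l • c := by
    have := h.val (h.dsw m)
    rw [h.sw23 d a b, h.swap12 a d, LinearMap.neg_apply, h.sw23 a b d, h.swap12 b a,
      LinearMap.neg_apply, this]; simp
  have neg1 : ∀ x y : V, A (-x) y = - A x y := fun x y => by
    have := h.smul1 (-1) x y
    simpa using this
  have neg2 : ∀ x y : V, A x (-y) = - A x y := fun x y => by
    have := h.smul2 (-1) x y
    simpa using this
  have z1 : ∀ x : V, A 0 x = 0 := fun x => by simpa using h.smul1 0 0 x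
  have z2 : ∀ x : V, A x 0 = 0 := fun x => by simpa using h.smul2 0 x 0
  refine triple_id (A c d) (A a d) (A d b) l (h.skew _ _) (h.skew _ _) (h.skew _ _) ?_ ?_ ?_ u
  · intro y
    rw [h.comm c d d b, h.self2, z1, va, neg2, h.smul2, h.swap12 a d]; simp
  · intro y
    rw [h.comm a d c d, h.self2, z2, vb, neg1, h.smul1, h.swap12 d b]; simp
  · intro y
    rw [h.comm d b a d, h.self3, z2, vc, h.smul1]; simp

theorem step (h : Four A l) {a b c d : V} (m : Mx A l a b c d) (u : V) (hu : ⟪a, u⟫ = 0) (t : ℝ) :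
    t * (‖A c d u‖ ^ 2 + ‖A d b u‖ ^ 2 + ‖A b c u‖ ^ 2)
      + t ^ 2 * (l / 2) * ((‖A c d u‖ ^ 2 + ‖A d b u‖ ^ 2 + ‖A b c u‖ ^ 2)
        - (‖A a b u‖ ^ 2 + ‖A a c u‖ ^ 2 + ‖A a d u‖ ^ 2)) ≤ l / 2 * ‖u‖ ^ 2 := by
  have m2 := h.rot (h.dsw m)
  have m3 := h.rot (h.dsw m2)
  have t1 := h.tri m u
  have t2 := h.tri m2 u
  have t3 := h.tri m3 u
  have va : A c b d = l • a := h.val (h.dsw (h.rot m))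
  have hq : ⟪b, t • A c d u⟫ = 0 := by
    rw [inner_smul_right, real_inner_comm, h.s34 c d b u, h.sw23 c b d, va, inner_neg_left,
      inner_smul_left, hu]; simp
  have hr : ⟪c, t • A d b u⟫ = 0 := by
    rw [inner_smul_right, real_inner_comm, h.s34 d b c u, h.sw23 d c b, h.swap12 c d,
      LinearMap.neg_apply, h.sw23 c b d, va, inner_neg_left, inner_neg_left, inner_neg_left,
      inner_smul_left, hu]; simp
  have hs : ⟪d, t • A b c u⟫ = 0 := by
    rw [inner_smul_right, real_inner_comm, h.s34 b c d u, h.swap12 c b,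
      LinearMap.neg_apply, va, inner_neg_left,
      inner_smul_left, hu]; simp
  have := h.ineq m u _ _ _ hu hq hr hs
  have f : ⟪A c a (A c d u), A b c u⟫ = ⟪A a c (A b c u), A c d u⟫ := by
    rw [h.skew, h.swap12 a c, real_inner_comm]; simp
  simp only [map_smul, inner_smul_left, inner_smul_right, conj_trivial, norm_smul, mul_pow,
    Real.norm_eq_abs, sq_abs, real_inner_self_eq_norm_sq, f] at this
  rw [t1] at this
  rw [t2, t3] at this
  linarith

theorem core (h : Four A l) {a b c d : V} (m : Mx A l a b c d) (u : V) (ha : ⟪a, u⟫ = 0) (hb : ⟪b, u⟫ = 0)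
    (hc : ⟪c, u⟫ = 0) (hd : ⟪d, u⟫ = 0) : A a b u = 0 := by
  have nn : ∀ x y : V, ‖A x y u‖ = ‖A y x u‖ := fun x y => by
    rw [h.swap12 y x, LinearMap.neg_apply, norm_neg]
  have m4 : Mx A l d c b a := h.rot (h.rot (h.dsw (h.rot m)))
  set C := ‖A a b u‖ ^ 2 + ‖A a c u‖ ^ 2 + ‖A a d u‖ ^ 2 + ‖A b c u‖ ^ 2 + ‖A b d u‖ ^ 2
    + ‖A c d u‖ ^ 2 with hC
  have hh : ∀ t : ℝ, t * C ≤ l * ‖u‖ ^ 2 := by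
    intro t
    have h1 := h.step m u ha t
    have h2 := h.step (h.dsw m) u hb t
    have h3 := h.step (h.dsw m4) u hc t
    have h4 := h.step m4 u hd t
    rw [nn d b] at h1
    rw [nn d c, nn c a, nn b a] at h2
    rw [nn b d, nn d a, nn c a, nn c b] at h3
    rw [nn b a, nn c b, nn d c, nn d b, nn d a] at h4
    rw [hC]
    rw [nn d b] at h3
    linarith
  have hC0 : C ≤ 0 := by
    by_contra hn
    push Not at hn
    have := hh ((l * ‖u‖ ^ 2 + 1) / C)
    rw [div_mul_cancel₀ _ hn.ne'] at this
    linarith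
  have h0 : ‖A a b u‖ ^ 2 ≤ 0 := by
    have : 0 ≤ ‖A a c u‖ ^ 2 + ‖A a d u‖ ^ 2 + ‖A b c u‖ ^ 2 + ‖A b d u‖ ^ 2
      + ‖A c d u‖ ^ 2 := by positivity
    linarith
  have h3 : ‖A a b u‖ = 0 := by nlinarith [norm_nonneg (A a b u)]
  exact norm_eq_zero.mp h3

end Four
theorem snoc_swap_last {k : ℕ} (f : Fin k → V) (a b : V) :
    (Fin.snoc (Fin.snoc f b : Fin (k + 1) → V) a : Fin (k + 2) → V) =
      (Fin.snoc (Fin.snoc f a : Fin (k + 1) → V) b : Fin (k + 2) → V) ∘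
        Equiv.swap (Fin.last k).castSucc (Fin.last (k + 1)) := by
  funext i
  refine Fin.lastCases ?_ (fun i => ?_) i
  · simp
  refine Fin.lastCases ?_ (fun i => ?_) i
  · simp
  · rw [Function.comp_apply, Equiv.swap_apply_of_ne_of_ne]
    · simp
    · exact fun hh => (Fin.castSucc_lt_last i).ne (Fin.castSucc_injective _ hh)
    · exact (Fin.castSucc_lt_last _).ne

theorem snoc_comp_swap {k : ℕ} (f : Fin k → V) (x : V) (i j : Fin k) :
    (Fin.snoc (f ∘ Equiv.swap i j) x : Fin (k + 1) → V) =
      (Fin.snoc f x : Fin (k + 1) → V) ∘ Equiv.swap i.castSucc j.castSucc := by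
  funext q
  refine Fin.lastCases ?_ (fun q => ?_) q
  · rw [Function.comp_apply, Equiv.swap_apply_of_ne_of_ne]
    · simp
    · exact (Fin.castSucc_lt_last _).ne'
    · exact (Fin.castSucc_lt_last _).ne'
  · simp only [Fin.snoc_castSucc, Function.comp_apply]
    rw [← (Fin.castSucc_injective k).map_swap]
    simp

theorem F_self {n : ℕ} (T : AlternatingMap ℝ V ℝ (Fin (n + 2 + 2)))
    (F : (Fin (n + 2) → V) → V →ₗ[ℝ] V)
    (hF1 : ∀ ζ, ∀ Y Z : V, ⟪F ζ Y, Z⟫ = T (Fin.snoc (Fin.snoc ζ Y) Z)) :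
    ∀ ζ i, F ζ (ζ i) = 0 := by
  intro ζ i
  apply ext_inner_right ℝ
  intro Z
  rw [hF1, inner_zero_left]
  apply T.map_eq_zero_of_eq _ (i := i.castSucc.castSucc) (j := (Fin.last _).castSucc)
  · simp
  · exact fun hh => (Fin.castSucc_lt_last i).ne (Fin.castSucc_injective _ hh)

theorem four_of_plucker {n : ℕ} (T : AlternatingMap ℝ V ℝ (Fin (n + 2 + 2)))
    (F : (Fin (n + 2) → V) → V →ₗ[ℝ] V)
    (hF1 : ∀ ζ, ∀ Y Z : V, ⟪F ζ Y, Z⟫ = T (Fin.snoc (Fin.snoc ζ Y) Z))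
    (hF2 : ∀ ζ, ∀ X : Fin (n + 2 + 2) → V, ∑ j, T (Function.update X j (F ζ (X j))) = 0)
    (l : ℝ) (hl : 0 < l) (bd : ∀ v, T v ≤ l * ∏ i, ‖v i‖) (r : Fin n → V) (hr : ∀ i, ‖r i‖ = 1) :
    Four (fun a b => F (Fin.snoc (Fin.snoc r a : Fin (n + 1) → V) b)) l := by
  have hF0 := F_self T F hF1
  refine ⟨?_, ?_, ?_, ?_, ?_, hl⟩
  · intro a b c d
    simp only [hF1]
    rw [snoc_swap_last r a b, snoc_comp_swap, snoc_comp_swap, T.map_swap]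
    exact ne_of_apply_ne Fin.val (by simp)
  · intro a b c d
    simp only [hF1]
    rw [snoc_swap_last (Fin.snoc r a : Fin (n + 1) → V) b c, snoc_comp_swap, T.map_swap]
    exact ne_of_apply_ne Fin.val (by simp)
  · intro a b c d
    simp only [hF1]
    rw [snoc_swap_last, T.map_swap]
    exact ne_of_apply_ne Fin.val (by simp)
  · intro a b x y z w
    have := hF2 (Fin.snoc (Fin.snoc r a : Fin (n + 1) → V) b)
      (Fin.snoc (Fin.snoc (Fin.snoc (Fin.snoc r x : Fin (n + 1) → V) y : Fin (n + 2) → V) z :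
        Fin (n + 3) → V) w)
    simp only [Fin.sum_univ_castSucc, Fin.snoc_castSucc, Fin.snoc_last, ← Fin.snoc_update,
      Fin.update_snoc_last] at this
    have z0 : ∀ i, F (Fin.snoc (Fin.snoc r a : Fin (n + 1) → V) b) (r i) = 0 := by
      intro i
      simpa using hF0 (Fin.snoc (Fin.snoc r a : Fin (n + 1) → V) b) i.castSucc.castSucc
    have z1 : ∀ i, T (Fin.snoc (Fin.snoc (Fin.snoc (Fin.snoc (Function.update r i
        (F (Fin.snoc (Fin.snoc r a : Fin (n + 1) → V) b) (r i))) x : Fin (n + 1) → V) y :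
          Fin (n + 2) → V) z : Fin (n + 3) → V) w) = 0 := by
      intro i
      rw [z0]
      apply T.map_coord_zero i.castSucc.castSucc.castSucc.castSucc
      simp
    simp only [z1, Finset.sum_const_zero, zero_add] at this
    simp only [hF1]
    exact this
  · intro a b c d
    simp only [hF1]
    refine (bd _).trans (le_of_eq ?_)
    simp [Fin.prod_univ_castSucc, hr]

theorem kill_perp {n : ℕ} (T : AlternatingMap ℝ V ℝ (Fin (n + 2 + 2)))
    (F : (Fin (n + 2) → V) → V →ₗ[ℝ] V)
    (hF1 : ∀ ζ, ∀ Y Z : V, ⟪F ζ Y, Z⟫ = T (Fin.snoc (Fin.snoc ζ Y) Z))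
    (hF2 : ∀ ζ, ∀ X : Fin (n + 2 + 2) → V, ∑ j, T (Function.update X j (F ζ (X j))) = 0)
    (l : ℝ) (hl : 0 < l) (bd : ∀ v, T v ≤ l * ∏ i, ‖v i‖)
    (e : Fin (n + 2 + 2) → V) (he : ∀ i, ‖e i‖ = 1) (hTe : |T e| = l) (u : V)
    (hu : ∀ i, ⟪e i, u⟫ = 0) :
    F (Fin.init (Fin.init e : Fin (n + 3) → V)) u = 0 := by
  have h4 := four_of_plucker T F hF1 hF2 l hl bd
    (Fin.init (Fin.init (Fin.init (Fin.init e : Fin (n + 3) → V) : Fin (n + 2) → V) :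
      Fin (n + 1) → V)) (fun i => he _)
  set a := (Fin.init (Fin.init e : Fin (n + 3) → V) : Fin (n + 2) → V) (Fin.last n).castSucc with ha
  set b := (Fin.init (Fin.init e : Fin (n + 3) → V) : Fin (n + 2) → V) (Fin.last (n+1)) with hb
  set c := (Fin.init e : Fin (n + 3) → V) (Fin.last (n + 2)) with hc
  set d := e (Fin.last (n + 3)) with hd
  have e2 : (Fin.snoc (Fin.snoc (Fin.init (Fin.init (Fin.init (Fin.init e : Fin (n + 3) → V) :
      Fin (n + 2) → V) : Fin (n + 1) → V)) a : Fin (n + 1) → V) b : Fin (n + 2) → V)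
      = Fin.init (Fin.init e : Fin (n + 3) → V) := by
    have : a = (Fin.init (Fin.init (Fin.init e : Fin (n + 3) → V) : Fin (n + 2) → V) :
      Fin (n + 1) → V) (Fin.last n) := rfl
    rw [this, Fin.snoc_init_self, hb, Fin.snoc_init_self]
  have e4 : (Fin.snoc (Fin.snoc (Fin.init (Fin.init e : Fin (n + 3) → V) :
      Fin (n + 2) → V) c : Fin (n + 3) → V) d : Fin (n + 4) → V) = e := by
    rw [hc, hd, Fin.snoc_init_self, Fin.snoc_init_self]
  have key : ⟪F (Fin.snoc (Fin.snoc (Fin.init (Fin.init (Fin.init (Fin.init e : Fin (n + 3) → V) :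
      Fin (n + 2) → V) : Fin (n + 1) → V)) a : Fin (n + 1) → V) b : Fin (n + 2) → V) c, d⟫
      = T e := by
    rw [e2, hF1, e4]
  rw [← e2]
  rcases abs_eq_abs.mp (hTe.trans (abs_of_pos hl).symm) with hp | hn
  · exact h4.core (a := a) (b := b) (c := c) (d := d)
      ⟨he _, he _, he _, he _, key.trans hp⟩ u (hu _) (hu _) (hu _) (hu _)
  · refine h4.core (a := a) (b := b) (c := d) (d := c)
      ⟨he _, he _, he _, he _, (h4.s34 a b c d).trans ?_⟩ u (hu _) (hu _) (hu _) (hu _)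
    rw [neg_eq_iff_eq_neg]
    exact key.trans hn

theorem exists_max {k : ℕ} (hk : 0 < k) (T : AlternatingMap ℝ V ℝ (Fin k)) (hT : T ≠ 0) :
    ∃ (l : ℝ) (e : Fin k → V), 0 < l ∧ (∀ i, ‖e i‖ = 1) ∧ T e = l ∧
      ∀ v, T v ≤ l * ∏ i, ‖v i‖ := by
  have hcont : Continuous T := by
    have hb := Module.finBasis ℝ V
    have : ∀ v, T v = ∑ s : Fin k → Fin (Module.finrank ℝ V),
        (∏ i, hb.repr (v i) (s i)) * T (fun i => hb (s i)) := by
      intro v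
      conv_lhs => rw [show v = fun i => ∑ j, hb.repr (v i) j • hb j from
        funext fun i => (hb.sum_repr _).symm]
      have := T.toMultilinearMap.map_sum (fun i j => hb.repr (v i) j • hb j)
      refine this.trans (Finset.sum_congr rfl fun s _ => ?_)
      have := T.toMultilinearMap.map_smul_univ (fun i => hb.repr (v i) (s i)) (fun i => hb (s i))
      exact this
    rw [show (T : (Fin k → V) → ℝ) = _ from funext this]
    refine continuous_finsetSum _ fun s _ => Continuous.mul ?_ continuous_const
    refine continuous_finsetProd _ fun i _ => ?_
    exact (LinearMap.continuous_of_finiteDimensional (hb.coord (s i))).comp (continuous_apply i)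
  have hK : IsCompact (Set.univ.pi fun _ : Fin k => Metric.closedBall (0 : V) 1) :=
    isCompact_univ_pi fun _ => isCompact_closedBall 0 1
  obtain ⟨e, heK, hmax⟩ := hK.exists_isMaxOn ⟨0, by simp⟩ hcont.continuousOn
  have heK' : ∀ i, ‖e i‖ ≤ 1 := fun i => by simpa using heK i (Set.mem_univ i)
  have bd : ∀ v, T v ≤ T e * ∏ i, ‖v i‖ := by
    intro v
    by_cases hv : ∃ i, v i = 0
    · obtain ⟨i, hi⟩ := hv
      rw [T.map_coord_zero i hi, Finset.prod_eq_zero (Finset.mem_univ i) (by simp [hi])]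
      simp
    · push Not at hv
      have h1 := hmax (a := fun i => ‖v i‖⁻¹ • v i) (by
        intro i _
        simp [norm_smul, inv_mul_cancel₀ (norm_ne_zero_iff.mpr (hv i))])
      have h2 : T (fun i => ‖v i‖⁻¹ • v i) = (∏ i, ‖v i‖⁻¹) * T v :=
        T.toMultilinearMap.map_smul_univ _ _
      have h1' : (∏ i, ‖v i‖⁻¹) * T v ≤ T e := h2 ▸ h1
      have hpos : 0 < ∏ i, ‖v i‖ := Finset.prod_pos fun i _ => norm_pos_iff.mpr (hv i)
      rw [Finset.prod_inv_distrib, inv_mul_le_iff₀ hpos] at h1'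
      linarith
  have hpos : 0 < T e := by
    obtain ⟨v, hv⟩ : ∃ v, T v ≠ 0 := by
      by_contra hh
      push Not at hh
      exact hT (AlternatingMap.ext hh)
    have hn : ∀ v, -T v ≤ T e * ∏ i, ‖v i‖ := by
      intro v
      have h1 := bd (Function.update v ⟨0, hk⟩ ((-1 : ℝ) • (v ⟨0, hk⟩)))
      rw [T.map_update_smul, Function.update_eq_self] at h1
      refine le_trans (by simp) (h1.trans (le_of_eq ?_))
      congr 1
      refine Finset.prod_congr rfl fun i _ => ?_
      by_cases hi : i = ⟨0, hk⟩
      · subst hi; simp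
      · rw [Function.update_of_ne hi]
    by_contra hneg
    push Not at hneg
    have hp : 0 ≤ ∏ i, ‖v i‖ := Finset.prod_nonneg fun i _ => norm_nonneg _
    have h1 := bd v
    have h2 := hn v
    have h3 : T e * ∏ i, ‖v i‖ ≤ 0 := mul_nonpos_of_nonpos_of_nonneg hneg hp
    apply hv
    linarith
  refine ⟨T e, e, hpos, fun i => ?_, rfl, bd⟩
  have h1 := bd e
  have h2 : 1 ≤ ∏ i, ‖e i‖ := by
    by_contra hh
    push Not at hh
    nlinarith
  refine le_antisymm (heK' i) (h2.trans ?_)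
  rw [← Finset.mul_prod_erase _ _ (Finset.mem_univ i)]
  exact mul_le_of_le_one_right (norm_nonneg _)
    (Finset.prod_le_one (fun _ _ => norm_nonneg _) fun j _ => heK' j)

theorem first_order {k : ℕ} (T : AlternatingMap ℝ V ℝ (Fin k)) (l : ℝ)
    (bd : ∀ v, T v ≤ l * ∏ i, ‖v i‖) (e : Fin k → V) (he : ∀ i, ‖e i‖ = 1) (hTe : |T e| = l)
    (i : Fin k) (x : V) : T (Function.update e i x) = T e * ⟪e i, x⟫ := by
  obtain ⟨w, hw⟩ : ∃ w : V, ∀ x, ⟪w, x⟫ = T (Function.update e i x) := by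
    let f : V →ₗ[ℝ] ℝ := T.toMultilinearMap.toLinearMap e i
    refine ⟨(InnerProductSpace.toDual ℝ V).symm (LinearMap.toContinuousLinearMap f), fun x => ?_⟩
    rw [InnerProductSpace.toDual_symm_apply]
    rfl
  have := riesz_eq w (e i) l (T e) (fun x => ?_) (he i) (by rw [hw]; simp) hTe
  · rw [← hw, this, inner_smul_left]; simp
  · rw [hw]
    refine (bd _).trans (le_of_eq ?_)
    congr 1
    rw [← Finset.mul_prod_erase _ _ (Finset.mem_univ i)]
    rw [Finset.prod_eq_one]
    · simp
    · intro j hj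
      rw [Function.update_of_ne (Finset.ne_of_mem_erase hj), he]

theorem max_orthonormal {k : ℕ} (T : AlternatingMap ℝ V ℝ (Fin k)) (l : ℝ) (hl : 0 < l)
    (bd : ∀ v, T v ≤ l * ∏ i, ‖v i‖) (e : Fin k → V) (he : ∀ i, ‖e i‖ = 1) (hTe : T e = l) :
    Orthonormal ℝ e := by
  refine ⟨he, fun i j hij => ?_⟩
  have := first_order T l bd e he (by rw [hTe, abs_of_pos hl]) i (e j)
  rw [T.map_update_self _ hij, hTe] at this
  rcases mul_eq_zero.mp this.symm with h | h
  · exact absurd h hl.ne'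
  · exact h
theorem sP_zero (K : Submodule ℝ V) {x : V} (hx : x ∈ Kᗮ) : K.starProjection x = 0 := by
  rw [Submodule.starProjection_apply, Submodule.orthogonalProjectionOnto_apply_of_mem_orthogonal hx]
  rfl

theorem exists_perm_two {k : ℕ} (i j : Fin (k + 2)) (hij : j ≠ i) :
    ∃ σ : Equiv.Perm (Fin (k + 2)), σ (Fin.last (k + 1)) = i ∧ σ (Fin.last k).castSucc = j := by
  have h1 : (Fin.last k).castSucc ≠ Fin.last (k + 1) := (Fin.castSucc_lt_last _).ne
  have h2 : Equiv.swap (Fin.last (k + 1)) i j ≠ Fin.last (k + 1) := by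
    intro hh
    apply hij
    have := congrArg (Equiv.swap (Fin.last (k + 1)) i) hh
    simpa using this
  refine ⟨Equiv.swap (Fin.last (k + 1)) i *
    Equiv.swap (Equiv.swap (Fin.last (k + 1)) i j) (Fin.last k).castSucc, ?_, ?_⟩
  · rw [Equiv.Perm.mul_apply, Equiv.swap_apply_of_ne_of_ne h2.symm h1.symm, Equiv.swap_apply_left]
  · rw [Equiv.Perm.mul_apply, Equiv.swap_apply_right, Equiv.swap_apply_self]

theorem mixed {n : ℕ} (T : AlternatingMap ℝ V ℝ (Fin (n + 2 + 2)))
    (F : (Fin (n + 2) → V) → V →ₗ[ℝ] V)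
    (hF1 : ∀ ζ, ∀ Y Z : V, ⟪F ζ Y, Z⟫ = T (Fin.snoc (Fin.snoc ζ Y) Z))
    (hF2 : ∀ ζ, ∀ X : Fin (n + 2 + 2) → V, ∑ j, T (Function.update X j (F ζ (X j))) = 0)
    (l : ℝ) (hl : 0 < l) (bd : ∀ v, T v ≤ l * ∏ i, ‖v i‖)
    (e : Fin (n + 2 + 2) → V) (he : Orthonormal ℝ e) (hTe : T e = l)
    (X : Fin (n + 2 + 2) → V) (hX : Function.Injective X)
    (hX2 : ∀ k, (∃ i, X k = e i) ∨ ∀ i, ⟪e i, X k⟫ = 0)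
    (a c : Fin (n + 2 + 2)) (i : Fin (n + 2 + 2)) (ha : X a = e i)
    (hc : ∀ i, ⟪e i, X c⟫ = 0) : T X = 0 := by
  obtain ⟨j, hj⟩ : ∃ j, ∀ k, X k ≠ e j := by
    by_contra hh
    push Not at hh
    choose g hg using hh
    have hgi : Function.Injective g := by
      intro x y hxy
      have := hg x
      rw [hxy, hg y] at this
      exact he.linearIndependent.injective this.symm
    obtain ⟨j, hj⟩ := Finite.surjective_of_injective hgi c
    have h1 := hc j
    rw [← hj, hg j, real_inner_self_eq_norm_sq, he.1 j] at h1
    norm_num at h1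
  have hji : j ≠ i := by
    rintro rfl
    exact hj a ha
  obtain ⟨σ, hσi, hσj⟩ := exists_perm_two i j hji
  have hTe' : |T (e ∘ σ)| = l := by
    rw [T.map_perm, hTe]
    rcases Int.units_eq_one_or (Equiv.Perm.sign σ) with h | h <;> simp [h, abs_of_pos hl]
  have hn : ∀ k, ‖(e ∘ σ) k‖ = 1 := fun k => he.1 _
  have hperp : ∀ u, (∀ k, ⟪e k, u⟫ = 0) →
      F (Fin.init (Fin.init (e ∘ σ) : Fin (n + 3) → V)) u = 0 := fun u hu =>
    kill_perp T F hF1 hF2 l hl bd (e ∘ σ) hn hTe' u (fun k => hu _)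
  have hj' : F (Fin.init (Fin.init (e ∘ σ) : Fin (n + 3) → V)) (e j) = T (e ∘ σ) • e i := by
    apply ext_inner_right ℝ
    intro Z
    have e1 : e j = (Fin.init (e ∘ σ) : Fin (n + 3) → V) (Fin.last (n + 2)) := by
      rw [← hσj]; rfl
    have e2 : (Fin.snoc (Fin.init (e ∘ σ) : Fin (n + 3) → V) Z : Fin (n + 4) → V)
        = Function.update (e ∘ σ) (Fin.last (n + 3)) Z := by
      conv_rhs => rw [← Fin.snoc_init_self (e ∘ σ), Fin.update_snoc_last]
    rw [hF1, e1, Fin.snoc_init_self, e2, first_order T l bd _ hn hTe', inner_smul_left,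
      Function.comp_apply, hσi]
    simp
  have hl' : ∀ k, k ≠ i → k ≠ j → F (Fin.init (Fin.init (e ∘ σ) : Fin (n + 3) → V)) (e k) = 0 := by
    intro k hki hkj
    obtain ⟨q, rfl⟩ := σ.surjective k
    induction q using Fin.lastCases with
    | last => exact absurd hσi hki
    | cast q =>
      induction q using Fin.lastCases with
      | last => exact absurd hσj hkj
      | cast q => exact F_self T F hF1 (Fin.init (Fin.init (e ∘ σ) : Fin (n + 3) → V)) q
  have hsum := hF2 (Fin.init (Fin.init (e ∘ σ) : Fin (n + 3) → V)) (Function.update X a (e j))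
  rw [Finset.sum_eq_single a] at hsum
  · rw [Function.update_self, hj', Function.update_idem, T.map_update_smul, ← ha,
      Function.update_eq_self, smul_eq_mul] at hsum
    rcases mul_eq_zero.mp hsum with h | h
    · rw [h, abs_zero] at hTe'
      exact absurd hTe' hl.ne
    · exact h
  · intro k _ hka
    apply T.map_coord_zero k
    rw [Function.update_self, Function.update_of_ne hka]
    rcases hX2 k with ⟨q, hq⟩ | hq
    · rw [hq]
      apply hl'
      · rintro rfl
        exact hka (hX (hq.trans ha.symm))
      · rintro rfl
        exact hj k hq
    · exact hperp _ hq
  · simp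

theorem split_form {n : ℕ} (T : AlternatingMap ℝ V ℝ (Fin (n + 2 + 2)))
    (F : (Fin (n + 2) → V) → V →ₗ[ℝ] V)
    (hF1 : ∀ ζ, ∀ Y Z : V, ⟪F ζ Y, Z⟫ = T (Fin.snoc (Fin.snoc ζ Y) Z))
    (hF2 : ∀ ζ, ∀ X : Fin (n + 2 + 2) → V, ∑ j, T (Function.update X j (F ζ (X j))) = 0)
    (l : ℝ) (hl : 0 < l) (bd : ∀ v, T v ≤ l * ∏ i, ‖v i‖)
    (e : Fin (n + 2 + 2) → V) (he : Orthonormal ℝ e) (hTe : T e = l)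
    (W : Submodule ℝ V) (hW : W = Submodule.span ℝ (Set.range e)) :
    T = T.compLinearMap W.starProjection.toLinearMap
      + T.compLinearMap Wᗮ.starProjection.toLinearMap := by
  obtain ⟨s, b, hs, hb⟩ := he.toSubtypeRange.exists_orthonormalBasis_extension
  have hmemW : ∀ i, e i ∈ W := fun i => hW ▸ Submodule.subset_span ⟨i, rfl⟩
  have hperp : ∀ x, (∀ i, ⟪e i, x⟫ = 0) → x ∈ Wᗮ := by
    intro x hx
    rw [hW, Submodule.mem_orthogonal]
    intro w hw
    induction hw using Submodule.span_induction with
    | mem y hy => obtain ⟨i, rfl⟩ := hy; exact hx i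
    | zero => simp
    | add y z _ _ hy hz => rw [inner_add_left, hy, hz, add_zero]
    | smul t y _ hy => rw [inner_smul_left, hy, mul_zero]
  have hdich : ∀ q : s, (∃ i, b q = e i) ∨ ∀ i, ⟪e i, b q⟫ = 0 := by
    intro q
    by_cases hq : ∃ i, b q = e i
    · exact Or.inl hq
    · right
      intro i
      push Not at hq
      have h1 : b ⟨e i, hs ⟨i, rfl⟩⟩ = e i := by rw [hb]
      have h2 := b.orthonormal.2 (i := ⟨e i, hs ⟨i, rfl⟩⟩) (j := q) (by
        rintro rfl
        exact hq i h1)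
      rw [← h1]
      exact h2
  apply Module.Basis.ext_alternating b.toBasis
  intro v hv
  simp only [OrthonormalBasis.coe_toBasis, AlternatingMap.add_apply,
    AlternatingMap.compLinearMap_apply]
  by_cases h1 : ∀ k, ∃ i, b (v k) = e i
  · have hw : ∀ k, b (v k) ∈ W := fun k => by
      obtain ⟨i, hi⟩ := h1 k
      rw [hi]; exact hmemW i
    have z : T (fun k => Wᗮ.starProjection.toLinearMap (b (v k))) = 0 := by
      apply T.map_coord_zero 0
      exact sP_zero _ (Submodule.le_orthogonal_orthogonal W (hw 0))
    have z2 : (fun k => W.starProjection.toLinearMap (b (v k))) = fun k => b (v k) :=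
      funext fun k => Submodule.starProjection_eq_self_iff.mpr (hw k)
    exact (add_zero _).symm.trans (congrArg₂ _ (congrArg T z2.symm) z.symm)
  · push Not at h1
    obtain ⟨c, hc⟩ := h1
    have hc' : ∀ i, ⟪e i, b (v c)⟫ = 0 := (hdich (v c)).resolve_left (by simpa using hc)
    have z : T (fun k => W.starProjection.toLinearMap (b (v k))) = 0 := by
      apply T.map_coord_zero c
      exact sP_zero _ (hperp _ hc')
    by_cases h2 : ∃ a i, b (v a) = e i
    · obtain ⟨a, i, hai⟩ := h2
      have z2 : T (fun k => Wᗮ.starProjection.toLinearMap (b (v k))) = 0 := by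
        apply T.map_coord_zero a
        refine sP_zero _ ?_
        rw [hai]
        exact Submodule.le_orthogonal_orthogonal W (hmemW i)
      have z3 := mixed T F hF1 hF2 l hl bd e he hTe (fun k => b (v k))
        (fun x y hxy => hv (b.toBasis.injective (by simpa using hxy)))
        (fun k => hdich (v k)) a c i hai hc'
      exact z3.trans (by rw [← add_zero (0 : ℝ)]; exact congrArg₂ _ z.symm z2.symm)
    · push Not at h2
      have z2 : (fun k => Wᗮ.starProjection.toLinearMap (b (v k))) = fun k => b (v k) :=
        funext fun k => Submodule.starProjection_eq_self_iff.mpr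
          (hperp _ ((hdich (v k)).resolve_left (by simpa using h2 k)))
      exact (zero_add _).symm.trans (congrArg₂ _ z.symm (congrArg T z2.symm))

theorem decomp_aux {n : ℕ} (N : ℕ) : ∀ (T : AlternatingMap ℝ V ℝ (Fin (n + 2 + 2)))
    (_ : PluckerRel T) (K : Submodule ℝ V)
    (_ : ∀ X : Fin (n + 2 + 2) → V, ∀ i, X i ∈ K → T X = 0)
    (_ : Module.finrank ℝ V ≤ Module.finrank ℝ K + N),
    ∃ (d : ℕ) (Vs : Fin d → Submodule ℝ V)
      (Ts : Fin d → AlternatingMap ℝ V ℝ (Fin (n + 2 + 2))),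
      (∀ k, Module.finrank ℝ ↥(Vs k) = n + 2 + 2) ∧
      (∀ i j, i ≠ j → ∀ x ∈ Vs i, ∀ y ∈ Vs j, ⟪x, y⟫ = 0) ∧
      (∀ k, Ts k ≠ 0) ∧
      T = ∑ k, Ts k ∧
      (∀ k, ∀ (X : Fin (n + 2 + 2) → V) (i : Fin (n + 2 + 2)),
        (∀ v ∈ Vs k, ⟪X i, v⟫ = 0) → Ts k X = 0) ∧
      (∀ k, ∀ x ∈ Vs k, ∀ y ∈ K, ⟪x, y⟫ = 0) := by
  induction N with
  | zero =>
    intro T hT K hK hdim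
    have hKtop : K = ⊤ := Submodule.eq_top_of_finrank_eq
      (le_antisymm (Submodule.finrank_le K) (by simpa using hdim))
    refine ⟨0, Fin.elim0, Fin.elim0, fun k => k.elim0, fun k => k.elim0, fun k => k.elim0, ?_,
      fun k => k.elim0, fun k => k.elim0⟩
    ext X
    rw [hK X 0 (hKtop ▸ Submodule.mem_top)]
    simp
  | succ N ih =>
    intro T hT K hK hdim
    by_cases hT0 : T = 0
    · refine ⟨0, Fin.elim0, Fin.elim0, fun k => k.elim0, fun k => k.elim0, fun k => k.elim0, ?_,
        fun k => k.elim0, fun k => k.elim0⟩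
      simp [hT0]
    choose F hF1 hF2 using hT
    obtain ⟨l, e, hl, hen, hTe, bd⟩ := exists_max (by omega) T hT0
    have he := max_orthonormal T l hl bd e hen hTe
    obtain ⟨W, hW⟩ : ∃ W, W = Submodule.span ℝ (Set.range e) := ⟨_, rfl⟩
    have hsplit := split_form T F hF1 hF2 l hl bd e he hTe W hW
    have hmemW : ∀ i, e i ∈ W := fun i => hW ▸ Submodule.subset_span ⟨i, rfl⟩
    have hWK : W ≤ Kᗮ := by
      rw [hW, Submodule.span_le]
      rintro _ ⟨i, rfl⟩
      rw [SetLike.mem_coe, Submodule.mem_orthogonal]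
      intro y hy
      have h1 := first_order T l bd e hen (by rw [hTe, abs_of_pos hl]) i y
      rw [hK _ i (by simpa using hy), hTe] at h1
      rw [real_inner_comm]
      exact (mul_eq_zero.mp h1.symm).resolve_left hl.ne'
    have hKW : K ≤ Wᗮ := (Submodule.le_orthogonal_orthogonal K).trans
      (Submodule.orthogonal_le hWK)
    have hdimW : Module.finrank ℝ W = n + 2 + 2 := by
      rw [hW, finrank_span_eq_card he.linearIndependent, Fintype.card_fin]
    -- evaluation on mixed arguments
    have hmix : ∀ X : Fin (n + 2 + 2) → V, ∀ a c, X a ∈ W → X c ∈ Wᗮ → T X = 0 := by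
      intro X a c ha hc
      rw [hsplit, AlternatingMap.add_apply, AlternatingMap.compLinearMap_apply,
        AlternatingMap.compLinearMap_apply]
      rw [T.map_coord_zero c, T.map_coord_zero a, add_zero]
      · exact sP_zero _
          (Submodule.le_orthogonal_orthogonal W ha)
      · exact sP_zero _ hc
    set P : V →ₗ[ℝ] V := Wᗮ.starProjection.toLinearMap with hP
    have hPmem : ∀ x, P x ∈ Wᗮ := fun x => Submodule.starProjection_apply_mem _ x
    have hPeq : ∀ x ∈ Wᗮ, P x = x := fun x hx => Submodule.starProjection_eq_self_iff.mpr hx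
    have hPzero : ∀ x ∈ W, P x = 0 := fun x hx =>
      sP_zero _ (Submodule.le_orthogonal_orthogonal W hx)
    have hPsymm : ∀ x y, ⟪P x, y⟫ = ⟪x, P y⟫ := fun x y =>
      Submodule.inner_starProjection_left_eq_right _ x y
    have hPl : PluckerRel (T.compLinearMap P) := by
      intro ζ
      refine ⟨P ∘ₗ F (fun i => P (ζ i)) ∘ₗ P, ?_, ?_⟩
      · intro Y Z
        rw [LinearMap.comp_apply, LinearMap.comp_apply, hPsymm, hF1,
          AlternatingMap.compLinearMap_apply]
        congr 1
        have : ∀ (k : ℕ) (f : Fin k → V) (x : V), (Fin.snoc (fun i => P (f i)) (P x) :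
            Fin (k + 1) → V) = fun i => P ((Fin.snoc f x : Fin (k + 1) → V) i) :=
          fun k f x => (Fin.comp_snoc P f x).symm
        rw [this, this]
      · intro X
        rw [← hF2 (fun i => P (ζ i)) (fun i => P (X i))]
        refine Finset.sum_congr rfl fun j _ => ?_
        rw [AlternatingMap.compLinearMap_apply]
        congr 1
        funext k
        by_cases hk : k = j
        · subst hk
          rw [Function.update_self, Function.update_self, LinearMap.comp_apply,
            LinearMap.comp_apply, hPeq _ (hPmem _), hPeq]
          rw [Submodule.mem_orthogonal]
          intro w hw
          rw [real_inner_comm, hF1]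
          apply hmix _ (Fin.last _) (Fin.last _).castSucc
          · simpa using hw
          · simpa using hPmem (X k)
        · rw [Function.update_of_ne hk, Function.update_of_ne hk]
    have hKW0 : K ⊓ W = ⊥ := by
      rw [eq_bot_iff]
      rintro x ⟨hx1, hx2⟩
      have := Submodule.inner_right_of_mem_orthogonal hx2 (hKW hx1)
      simpa using this
    obtain ⟨d, Vs, Ts, c1, c2, c3, c4, c5, c6⟩ := ih (T.compLinearMap P) hPl (K ⊔ W) (by
      intro X i hi
      rw [AlternatingMap.compLinearMap_apply]
      obtain ⟨y, hy, w, hw, hyw⟩ := Submodule.mem_sup.mp hi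
      apply hK _ i
      rw [← hyw, map_add, hPzero w hw, add_zero, hPeq y (hKW hy)]
      exact hy) (by
      have := Submodule.finrank_sup_add_finrank_inf_eq K W
      rw [hKW0, finrank_bot, hdimW] at this
      omega)
    have hVW : ∀ k, ∀ x ∈ Vs k, ∀ y ∈ W, ⟪x, y⟫ = 0 := fun k x hx y hy =>
      c6 k x hx y (Submodule.mem_sup_right hy)
    refine ⟨d + 1, Fin.cons W Vs,
      Fin.cons (T.compLinearMap W.starProjection.toLinearMap) Ts, ?_, ?_, ?_, ?_, ?_, ?_⟩
    · intro k
      refine Fin.cases ?_ (fun k => ?_) k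
      · exact hdimW
      · exact c1 k
    · intro i j
      refine Fin.cases ?_ (fun i => ?_) i <;> refine Fin.cases ?_ (fun j => ?_) j
      · intro hh; exact absurd rfl hh
      · intro _ x hx y hy
        rw [real_inner_comm]
        exact hVW j y hy x hx
      · intro _ x hx y hy
        exact hVW i x hx y hy
      · intro hij
        exact c2 i j (fun hh => hij (by rw [hh]))
    · intro k
      refine Fin.cases ?_ (fun k => ?_) k
      · intro h0
        have h1 : T.compLinearMap W.starProjection.toLinearMap e = 0 := by
          have := congrArg (fun S => S e) h0
          exact this
        rw [AlternatingMap.compLinearMap_apply] at h1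
        have h2 : (fun i => W.starProjection.toLinearMap (e i)) = e :=
          funext fun i => Submodule.starProjection_eq_self_iff.mpr (hmemW i)
        have h3 : T e = 0 := (congrArg T h2).symm.trans h1
        exact hl.ne' (hTe.symm.trans h3)
      · exact c3 k
    · rw [Fin.sum_univ_succ]
      simp only [Fin.cons_zero, Fin.cons_succ]
      rw [← c4]
      exact hsplit
    · intro k
      refine Fin.cases ?_ (fun k => ?_) k
      · intro X i hi
        change T _ = 0
        apply T.map_coord_zero i
        refine sP_zero _ ?_
        rw [Submodule.mem_orthogonal']
        exact hi
      · exact c5 k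
    · intro k
      refine Fin.cases ?_ (fun k => ?_) k
      · intro x hx y hy
        exact Submodule.inner_right_of_mem_orthogonal hx (hKW hy)
      · intro x hx y hy
        exact c6 k x hx y (Submodule.mem_sup_left hy)

/-- A `p`-form (`p ≥ 4`) on a Euclidean vector space satisfying the Plücker-type
relations is decomposable: an orthogonal sum of simple forms. -/
theorem stmt_3
    (m : ℕ) (hp : 4 ≤ m + 2)
    (T : AlternatingMap ℝ V ℝ (Fin (m + 2))) (hTne : T ≠ 0)
    (hT : PluckerRel T) :
    ∃ (d : ℕ) (Vs : Fin d → Submodule ℝ V) (Ts : Fin d → AlternatingMap ℝ V ℝ (Fin (m + 2))),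
      -- pairwise orthogonal `p`-dimensional subspaces
      (∀ k, Module.finrank ℝ ↥(Vs k) = m + 2) ∧
      (∀ i j, i ≠ j → ∀ x ∈ Vs i, ∀ y ∈ Vs j, ⟪x, y⟫ = 0) ∧
      -- nonzero simple forms supported on the `Vs k` summing to `T`
      (∀ k, Ts k ≠ 0) ∧
      T = ∑ k, Ts k ∧
      (∀ k, ∀ (X : Fin (m + 2) → V) (i : Fin (m + 2)),
        (∀ v ∈ Vs k, ⟪X i, v⟫ = 0) → Ts k X = 0) := by

  obtain ⟨n, rfl⟩ : ∃ n, m = n + 2 := ⟨m - 2, by omega⟩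
  obtain ⟨d, Vs, Ts, c1, c2, c3, c4, c5, -⟩ := decomp_aux (Module.finrank ℝ V) T hT ⊥ (by
    intro X i hi
    exact T.map_coord_zero i ((Submodule.mem_bot ℝ).mp hi)) (by simp)
  exact ⟨d, Vs, Ts, c1, c2, c3, c4, c5⟩
end
end
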